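/- arXiv:2009.03150 — 6 statements merged into one kernel-verified Lean document; each statement's English description precedes it below -/
import Mathlib

section
/- Let λ ≠ λ′ be positive reals and let SS_{λ,λ′}(B_max) be the non-Euclidean stress-sheer matrix of the fully doubly braced m×n grid, with rows indexed by the edges of K²_{m,n}. Then a cycle of edges in K²_{m,n} corresponds to a circuit (a minimal linearly dependent set of rows) of SS_{λ,λ′}(B_max) if and only if the cycle has a dependent colouring. -/
open Asymptotics

abbrev V2 : Type := ℝ × ℝ

/-- The standard dot product on `ℝ × ℝ`. -/
def dot (v w : V2) : ℝ := v.1 * w.1 + v.2 * w.2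

/-- The Euclidean norm on `ℝ × ℝ`. -/
noncomputable def eucNorm (v : V2) : ℝ := Real.sqrt (v.1 ^ 2 + v.2 ^ 2)

/-- Rotation by `π/2`. -/
def rot90 (v : V2) : V2 := (-v.2, v.1)

/-- A bar-joint framework in the plane: a placement of joints and a set of bars. -/
structure Framework (J : Type) where
  pos : J → V2
  bars : Set (J × J)

/-- A Euclidean infinitesimal flex. -/
def IsEucFlex {J : Type} (F : Framework J) (u : J → V2) : Prop :=
  ∀ e ∈ F.bars, dot (u e.1 - u e.2) (F.pos e.1 - F.pos e.2) = 0

/-- A Euclidean rigid motion flex: `u i = c + θ • J (p i)`. -/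
def IsRigidMotionFlex {J : Type} (F : Framework J) (u : J → V2) : Prop :=
  ∃ (c : V2) (θ : ℝ), ∀ i, u i = c + θ • rot90 (F.pos i)

/-- Euclidean infinitesimal rigidity. -/
def EucRigid {J : Type} (F : Framework J) : Prop :=
  ∀ u, IsEucFlex F u → IsRigidMotionFlex F u

/-- An infinitesimal flex with respect to a general norm `ν`:
`ν (p i + t u i - (p j + t u j)) - ν (p i - p j) = o(t)` as `t → 0+`, for each bar. -/
def IsFlex (ν : V2 → ℝ) {J : Type} (F : Framework J) (u : J → V2) : Prop :=
  ∀ e ∈ F.bars,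
    (fun t : ℝ =>
        ν (F.pos e.1 + t • u e.1 - (F.pos e.2 + t • u e.2)) - ν (F.pos e.1 - F.pos e.2))
      =o[nhdsWithin 0 (Set.Ioi 0)] (id : ℝ → ℝ)

/-- Infinitesimal rigidity for a (non-Euclidean) norm: every flex is a translation,
i.e. a constant velocity field. -/
def NormRigid (ν : V2 → ℝ) {J : Type} (F : Framework J) : Prop :=
  ∀ u, IsFlex ν F u → ∀ i j, u i = u j

/-- `ν` is a norm on `ℝ²`. -/
def IsNormFn (ν : V2 → ℝ) : Prop :=
  (∀ v, ν v = 0 ↔ v = 0) ∧ (∀ (c : ℝ) (v : V2), ν (c • v) = |c| * ν v) ∧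
    ∀ v w : V2, ν (v + w) ≤ ν v + ν w

/-- `ν` is differentiable (away from the origin). -/
def SmoothNorm (ν : V2 → ℝ) : Prop := ∀ v : V2, v ≠ 0 → DifferentiableAt ℝ ν v

/-- `ν` is strictly convex. -/
def StrictlyConvexNorm (ν : V2 → ℝ) : Prop :=
  ∀ v w : V2, ν v = 1 → ν w = 1 → v ≠ w → ν ((1 / 2 : ℝ) • (v + w)) < 1

/-- `ν` is not a scalar multiple of the Euclidean norm. -/
def NonEuclidean (ν : V2 → ℝ) : Prop := ¬∃ c : ℝ, ∀ v, ν v = c * eucNorm v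

/-- The point of the unit sphere of `ν` in the direction `θ`. -/
noncomputable def sphPt (ν : V2 → ℝ) (θ : ℝ) : V2 :=
  (ν (Real.cos θ, Real.sin θ))⁻¹ • ((Real.cos θ, Real.sin θ) : V2)

/-- `w` is tangent to the unit sphere of `ν` at the point `q`. -/
def IsTangentAt (ν : V2 → ℝ) (q w : V2) : Prop := fderiv ℝ ν q w = 0

/-- The positively oriented unit tangent vector to the unit sphere of `ν`
at its point in the direction `θ`. -/
def IsPosUnitTangent (ν : V2 → ℝ) (θ : ℝ) (w : V2) : Prop :=
  ν w = 1 ∧ IsTangentAt ν (sphPt ν θ) w ∧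
    0 < (sphPt ν θ).1 * w.2 - (sphPt ν θ).2 * w.1

/-- Rotation of the plane by the angle `α`. -/
noncomputable def rotv (α : ℝ) (v : V2) : V2 :=
  (v.1 * Real.cos α - v.2 * Real.sin α, v.1 * Real.sin α + v.2 * Real.cos α)

/-- The joints of the `m × n` grid. -/
abbrev Joint (m n : ℕ) := Fin (m + 1) × Fin (n + 1)

/-- A brace: a square `(j,k)` together with a colour (`true` = blue diagonal
from `(j,k)` to `(j+1,k+1)`, `false` = red diagonal from `(j+1,k)` to `(j,k+1)`). -/
abbrev Brace (m n : ℕ) := Fin m × Fin n × Bool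

/-- The bars of the unbraced `m × n` grid: unit horizontal and vertical segments. -/
def gridBars (m n : ℕ) : Set (Joint m n × Joint m n) :=
  {e | ((e.1.1 : ℕ) + 1 = (e.2.1 : ℕ) ∧ e.1.2 = e.2.2) ∨
      (e.1.1 = e.2.1 ∧ (e.1.2 : ℕ) + 1 = (e.2.2 : ℕ))}

/-- The bar corresponding to a brace. -/
def braceBar {m n : ℕ} (b : Brace m n) : Joint m n × Joint m n :=
  if b.2.2 then ((b.1.castSucc, b.2.1.castSucc), (b.1.succ, b.2.1.succ))
  else ((b.1.succ, b.2.1.castSucc), (b.1.castSucc, b.2.1.succ))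

/-- The axis-aligned braced `m × n` grid framework `G(B)`. -/
noncomputable def plainBracedGrid (m n : ℕ) (B : Set (Brace m n)) : Framework (Joint m n) where
  pos := fun v => ((v.1 : ℝ), (v.2 : ℝ))
  bars := gridBars m n ∪ braceBar '' B

/-- The braced `m × n` grid framework `G(B)` of inclination `α`. -/
noncomputable def bracedGrid (m n : ℕ) (α : ℝ) (B : Set (Brace m n)) : Framework (Joint m n) where
  pos := fun v => rotv α ((v.1 : ℝ), (v.2 : ℝ))
  bars := gridBars m n ∪ braceBar '' B

/-- The braced `m × n` grid of `a × b` rectangles with inclination `α`. -/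
noncomputable def bracedRectGrid (m n : ℕ) (a b α : ℝ) (B : Set (Brace m n)) :
    Framework (Joint m n) where
  pos := fun v => rotv α ((v.1 : ℝ) * a, (v.2 : ℝ) * b)
  bars := gridBars m n ∪ braceBar '' B

/-- The unbraced axis-aligned `m × n` grid framework. -/
noncomputable def unbracedGrid (m n : ℕ) : Framework (Joint m n) where
  pos := fun v => ((v.1 : ℝ), (v.2 : ℝ))
  bars := gridBars m n

/-- The lines of the grid: `Sum.inl k` is the horizontal line at height `k`,
`Sum.inr j` is the vertical line at abscissa `j`. -/
abbrev LineIdx (m n : ℕ) := Fin (n + 1) ⊕ Fin (m + 1)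

/-- The basis velocity field `u_l` supported on the joints of the line `l`. -/
def lineField (m n : ℕ) (l : LineIdx m n) : Joint m n → V2 := fun v =>
  match l with
  | Sum.inl k => if v.2 = k then (1, 0) else (0, 0)
  | Sum.inr j => if v.1 = j then (0, 1) else (0, 0)

/-- The ribbons of the grid: `Sum.inl j` is the vertical ribbon `[j,j+1] × [0,n]`,
`Sum.inr k` is the horizontal ribbon `[0,m] × [k,k+1]`. -/
abbrev RibbonIdx (m n : ℕ) := Fin m ⊕ Fin n

/-- The sheer map on coefficient fields: `σ(u)(ρ) = d_{l₁} - d_{l₂}` for the boundary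
lines `l₁` (right-hand, resp. lower) and `l₂` of the ribbon `ρ`. -/
def sheer {m n : ℕ} (d : LineIdx m n → ℝ) : RibbonIdx m n → ℝ := fun ρ =>
  match ρ with
  | Sum.inl j => d (Sum.inr j.succ) - d (Sum.inr j.castSucc)
  | Sum.inr k => d (Sum.inl k.castSucc) - d (Sum.inl k.succ)

/-- The row of the Euclidean stress-sheer matrix indexed by a brace. -/
def eucSSRow {m n : ℕ} (b : Brace m n) : RibbonIdx m n → ℝ := fun ρ =>
  match ρ with
  | Sum.inl j => if j = b.1 then 1 else 0
  | Sum.inr k => if k = b.2.1 then -1 else 0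

/-- The row of the Euclidean stress-sheer matrix of the fully braced grid
indexed by a square. -/
def eucSqRow {m n : ℕ} (s : Fin m × Fin n) : RibbonIdx m n → ℝ := fun ρ =>
  match ρ with
  | Sum.inl j => if j = s.1 then 1 else 0
  | Sum.inr k => if k = s.2 then -1 else 0

/-- The row of the non-Euclidean stress-sheer matrix `SS_{λ,λ'}` indexed by a brace:
`+1` at the vertical ribbon, `-λ` (blue) or `-λ'` (red) at the horizontal ribbon. -/
def neRow {m n : ℕ} (lam lam' : ℝ) (b : Brace m n) : RibbonIdx m n → ℝ := fun ρ =>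
  match ρ with
  | Sum.inl j => if j = b.1 then 1 else 0
  | Sum.inr k => if k = b.2.1 then (if b.2.2 then -lam else -lam') else 0

/-- Adjacency of rows (`Sum.inl`) and columns (`Sum.inr`) in the (bicoloured) braces
graph with edge set `B`. -/
def bracesAdj {m n : ℕ} (B : Set (Brace m n)) (v w : Fin m ⊕ Fin n) : Prop :=
  ∃ e ∈ B, (v = Sum.inl e.1 ∧ w = Sum.inr e.2.1) ∨ (w = Sum.inl e.1 ∧ v = Sum.inr e.2.1)

/-- A (bicoloured) cycle of length `2(k+1)` in `K²_{m,n}`: rows `row 0, …, row k`,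
columns `col 0, …, col k`, odd edges `e_{2i+1} = (row i, col i, c1 i)` and even edges
`e_{2i+2} = (row (i+1), col i, c2 i)` (cyclically); all `2(k+1)` edges are distinct. -/
structure BCycle (m n : ℕ) where
  k : ℕ
  row : Fin (k + 1) → Fin m
  col : Fin (k + 1) → Fin n
  c1 : Fin (k + 1) → Bool
  c2 : Fin (k + 1) → Bool
  rowInj : Function.Injective row
  colInj : Function.Injective col
  nontriv : k = 0 → c1 ≠ c2

/-- The odd edges of a bicoloured cycle. -/
def BCycle.edge1 {m n : ℕ} (C : BCycle m n) (i : Fin (C.k + 1)) : Brace m n :=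
  (C.row i, C.col i, C.c1 i)

/-- The even edges of a bicoloured cycle. -/
def BCycle.edge2 {m n : ℕ} (C : BCycle m n) (i : Fin (C.k + 1)) : Brace m n :=
  (C.row (i + 1), C.col i, C.c2 i)

/-- The edge set of a bicoloured cycle. -/
def BCycle.edges {m n : ℕ} (C : BCycle m n) : Set (Brace m n) :=
  Set.range C.edge1 ∪ Set.range C.edge2

/-- Dependent colouring: the number of blue edges in odd position equals the number
of blue edges in even position. -/
def BCycle.DepColouring {m n : ℕ} (C : BCycle m n) : Prop :=
  (Finset.univ.filter fun i => C.c1 i = true).card =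
    (Finset.univ.filter fun i => C.c2 i = true).card

/-- Linear independence of the set of rows of `SS_{λ,λ'}` indexed by `S`. -/
def RowsIndep (m n : ℕ) (lam lam' : ℝ) (S : Set (Brace m n)) : Prop :=
  LinearIndependent ℝ fun e : S => neRow lam lam' (e : Brace m n)

/-- `S` is a circuit of the row matroid of `SS_{λ,λ'}`: a minimal dependent set of rows. -/
def IsCircuit (m n : ℕ) (lam lam' : ℝ) (S : Set (Brace m n)) : Prop :=
  ¬RowsIndep m n lam lam' S ∧ ∀ S' ⊂ S, RowsIndep m n lam lam' S'

/-- `S ⊆ K²_{m,n}` is a spanning independent cycle-rooted forest: every connected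
component (of the multigraph with edge set `S` on the `m + n` vertices) has as many
edges as vertices, i.e. is a cycle-rooted tree (so in particular `S` is spanning),
and every cycle of edges in `S` has an independent colouring. -/
def IsSpanningICRF (m n : ℕ) (S : Set (Brace m n)) : Prop :=
  (∀ v : Fin m ⊕ Fin n,
      {e ∈ S | Relation.ReflTransGen (bracesAdj S) v (Sum.inl e.1)}.ncard =
        {w | Relation.ReflTransGen (bracesAdj S) v w}.ncard) ∧
  ∀ C : BCycle m n, C.edges ⊆ S → ¬C.DepColouring

/-- The `p`-norm on the plane. -/
noncomputable def pNorm (p : ℝ) : V2 → ℝ := fun v => (|v.1| ^ p + |v.2| ^ p) ^ (1 / p)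

/-- The sup norm on the plane. -/
noncomputable def supNorm : V2 → ℝ := fun v => max |v.1| |v.2|

/-- A solution of the cyclic recurrence `a i * x i = a (i + 1) * y i` which vanishes somewhere
vanishes everywhere. -/
theorem cyclic_eq_zero {k : ℕ} {a x y : Fin (k + 1) → ℝ} (hy : ∀ i, y i ≠ 0)
    (h : ∀ i, a i * x i = a (i + 1) * y i) {i : Fin (k + 1)} (hi : a i = 0) (j : Fin (k + 1)) :
    a j = 0 := by
  have key : ∀ t, a (i + t) = 0 := by
    intro t
    induction t using Fin.induction with
    | zero => simpa using hi
    | succ t ih =>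
      have := h (i + t.castSucc)
      rw [ih, zero_mul, add_assoc, Fin.coeSucc_eq_succ] at this
      exact (mul_eq_zero.mp this.symm).resolve_right (hy _)
  simpa using key (j - i)

/-- The cyclic recurrence `a i * x i = a (i + 1) * y i` has a nonzero solution iff the products
of the coefficients agree. -/
theorem exists_cyclic_iff_prod_eq {k : ℕ} {x y : Fin (k + 1) → ℝ} (hy : ∀ i, y i ≠ 0) :
    (∃ a : Fin (k + 1) → ℝ, a ≠ 0 ∧ ∀ i, a i * x i = a (i + 1) * y i) ↔
      ∏ i, x i = ∏ i, y i := by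
  constructor
  · rintro ⟨a, ha, h⟩
    have hne : ∏ i, a i ≠ 0 := Finset.prod_ne_zero_iff.mpr fun i _ hi =>
      ha (funext fun j => cyclic_eq_zero hy h hi j)
    have hshift : ∏ i, a (i + 1) = ∏ i, a i := Equiv.prod_comp (Equiv.addRight 1) a
    apply mul_left_cancel₀ hne
    calc (∏ i, a i) * ∏ i, x i = ∏ i, a i * x i := Finset.prod_mul_distrib.symm
      _ = ∏ i, a (i + 1) * y i := Finset.prod_congr rfl fun i _ => h i
      _ = _ := by rw [Finset.prod_mul_distrib, hshift]
  · intro h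
    let r : ℕ → ℝ := fun j => x (Fin.ofNat (k + 1) j) / y (Fin.ofNat (k + 1) j)
    have hr : ∀ i : Fin (k + 1), r i.val = x i / y i := fun i => by simp [r]
    have hprod : ∏ j ∈ Finset.range (k + 1), r j = 1 := by
      rw [Finset.prod_range]
      simp only [hr, Finset.prod_div_distrib, h]
      exact div_self (Finset.prod_ne_zero_iff.mpr fun i _ => hy i)
    refine ⟨fun i => ∏ j ∈ Finset.range i.val, r j, fun h0 => ?_, fun i => ?_⟩
    · simpa using congrFun h0 0
    · have hstep : (∏ j ∈ Finset.range (i + 1).val, r j) =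
          (∏ j ∈ Finset.range i.val, r j) * (x i / y i) := by
        rw [← hr, ← Finset.prod_range_succ]
        rcases eq_or_ne i (Fin.last k) with rfl | hi
        · simp [hprod]
        · rw [Fin.val_add_one_of_lt (Fin.lt_last_iff_ne_last.mpr hi)]
      simp only [hstep, mul_assoc, div_mul_cancel₀ _ (hy i)]

/-- The weight `λ` of a blue edge or `λ'` of a red edge. -/
def colourWeight (lam lam' : ℝ) (c : Bool) : ℝ := if c then lam else lam'

theorem colourWeight_ne_zero {lam lam' : ℝ} (hlam : 0 < lam) (hlam' : 0 < lam') (c : Bool) :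
    colourWeight lam lam' c ≠ 0 := by
  cases c <;> simp [colourWeight, hlam.ne', hlam'.ne']

theorem neRow_inl {m n : ℕ} (lam lam' : ℝ) (b : Brace m n) (j : Fin m) :
    neRow lam lam' b (Sum.inl j) = if j = b.1 then 1 else 0 := rfl

theorem neRow_inr {m n : ℕ} (lam lam' : ℝ) (b : Brace m n) (k : Fin n) :
    neRow lam lam' b (Sum.inr k) = if k = b.2.1 then -colourWeight lam lam' b.2.2 else 0 := by
  by_cases hb : b.2.2 <;> simp [neRow, colourWeight, hb]

theorem prod_colourWeight {ι : Type*} [Fintype ι] {lam lam' : ℝ} (hlam' : 0 < lam')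
    (c : ι → Bool) :
    ∏ i, colourWeight lam lam' (c i) =
      (lam / lam') ^ (Finset.univ.filter fun i => c i = true).card * lam' ^ Fintype.card ι := by
  have h : ∀ i, colourWeight lam lam' (c i) = (if c i = true then lam / lam' else 1) * lam' := by
    intro i
    cases hc : c i <;> simp [colourWeight, hlam'.ne']
  simp only [h, Finset.prod_mul_distrib, Finset.prod_ite, Finset.prod_const, one_pow, mul_one,
    Finset.card_univ]

theorem prod_colourWeight_eq_iff {ι : Type*} [Fintype ι] {lam lam' : ℝ} (hlam : 0 < lam)
    (hlam' : 0 < lam') (hne : lam ≠ lam') (c d : ι → Bool) :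
    ∏ i, colourWeight lam lam' (c i) = ∏ i, colourWeight lam lam' (d i) ↔
      (Finset.univ.filter fun i => c i = true).card =
        (Finset.univ.filter fun i => d i = true).card := by
  have h1 : lam / lam' ≠ 1 := fun h => hne ((div_eq_one_iff_eq hlam'.ne').mp h)
  rw [prod_colourWeight hlam', prod_colourWeight hlam', mul_left_inj' (pow_pos hlam' _).ne',
    pow_right_inj₀ (div_pos hlam hlam') h1]

/-- Independence of the rows in `S` in terms of coefficients on all braces supported on `S`. -/
theorem rowsIndep_iff {m n : ℕ} {lam lam' : ℝ} {S : Set (Brace m n)} :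
    RowsIndep m n lam lam' S ↔ ∀ g : Brace m n → ℝ, (∀ b ∉ S, g b = 0) →
      ∑ b, g b • neRow lam lam' b = 0 → g = 0 := by
  classical
  have hsum : ∀ g : Brace m n → ℝ, (∀ b ∉ S, g b = 0) →
      ∑ b : S, g b • neRow lam lam' (b : Brace m n) = ∑ b, g b • neRow lam lam' b := by
    intro g hg
    refine Fintype.sum_of_injective Subtype.val Subtype.val_injective _ _ (fun b hb => ?_)
      fun _ => rfl
    rw [hg b (by simpa using hb), zero_smul]
  rw [RowsIndep, Fintype.linearIndependent_iff]
  constructor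
  · intro h g hg h0
    funext b
    by_cases hb : b ∈ S
    · exact h (fun e => g e) ((hsum g hg).trans h0) ⟨b, hb⟩
    · exact hg b hb
  · intro h g h0 e
    let f : Brace m n → ℝ := fun b => if hb : b ∈ S then g ⟨b, hb⟩ else 0
    have hf : ∀ e : S, f e = g e := fun e => by simp [f]
    have hf0 : ∀ b ∉ S, f b = 0 := fun b hb => by simp [f, hb]
    rw [← hf, h f hf0 (by rw [← hsum f hf0]; simpa only [hf] using h0), Pi.zero_apply]

namespace BCycle

variable {m n : ℕ} (C : BCycle m n)

theorem edge1_injective : Function.Injective C.edge1 := fun _ _ h =>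
  C.rowInj (congrArg Prod.fst h)

theorem edge2_injective : Function.Injective C.edge2 := fun _ _ h =>
  C.colInj (congrArg (fun b => b.2.1) h)

theorem edge1_ne_edge2 (i j : Fin (C.k + 1)) : C.edge1 i ≠ C.edge2 j := by
  intro h
  obtain ⟨hrow, hcol, hc⟩ : C.row i = C.row (j + 1) ∧ C.col i = C.col j ∧ C.c1 i = C.c2 j := by
    simpa [edge1, edge2] using h
  obtain rfl := C.colInj hcol
  have hi : i = i + 1 := C.rowInj hrow
  have hk : C.k = 0 := by
    have h1 : (1 : Fin (C.k + 1)) = 0 := by simpa using hi.symm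
    simpa using h1
  have : Subsingleton (Fin (C.k + 1)) := Fin.subsingleton_iff_le_one.mpr (by omega)
  exact C.nontriv hk (funext fun l => by rw [Subsingleton.elim l i, hc])

theorem sum_eq_of_support {M : Type*} [AddCommMonoid M] {f : Brace m n → M}
    (hf : ∀ b ∉ C.edges, f b = 0) :
    ∑ b, f b = ∑ i, f (C.edge1 i) + ∑ i, f (C.edge2 i) := by
  have hinj : Function.Injective (Sum.elim C.edge1 C.edge2) :=
    C.edge1_injective.sumElim C.edge2_injective C.edge1_ne_edge2
  rw [← Fintype.sum_of_injective _ hinj (fun s => f (Sum.elim C.edge1 C.edge2 s)) f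
    (fun b hb => hf b (by rwa [edges, ← Set.Sum.elim_range])) fun _ => rfl]
  simp

/-- The linear dependencies between the rows of a cycle are given by a cyclic recurrence. -/
theorem sum_smul_neRow_eq_zero_iff {lam lam' : ℝ} {g : Brace m n → ℝ}
    (hg : ∀ b ∉ C.edges, g b = 0) :
    ∑ b, g b • neRow lam lam' b = 0 ↔
      (∀ i, g (C.edge2 i) = -g (C.edge1 (i + 1))) ∧
      ∀ i, g (C.edge1 i) * colourWeight lam lam' (C.c1 i) =
        g (C.edge1 (i + 1)) * colourWeight lam lam' (C.c2 i) := by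
  rw [C.sum_eq_of_support fun b hb => by rw [hg b hb, zero_smul]]
  have hshift : ∀ j : Fin m, ∑ i, (if j = C.row i then g (C.edge1 i) else 0) =
      ∑ i, (if j = C.row (i + 1) then g (C.edge1 (i + 1)) else 0) := fun j =>
    (Equiv.sum_comp (Equiv.addRight 1) fun i => if j = C.row i then g (C.edge1 i) else 0).symm
  have hinl : ∀ j : Fin m, (∑ i, g (C.edge1 i) • neRow lam lam' (C.edge1 i) +
      ∑ i, g (C.edge2 i) • neRow lam lam' (C.edge2 i)) (Sum.inl j) =
      ∑ i, if j = C.row (i + 1) then g (C.edge1 (i + 1)) + g (C.edge2 i) else 0 := by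
    intro j
    simp only [Pi.add_apply, Finset.sum_apply, Pi.smul_apply, neRow_inl, smul_eq_mul, mul_ite,
      mul_one, mul_zero]
    change ∑ i, (if j = C.row i then g (C.edge1 i) else 0) +
      ∑ i, (if j = C.row (i + 1) then g (C.edge2 i) else 0) = _
    rw [hshift, ← Finset.sum_add_distrib]
    exact Finset.sum_congr rfl fun i _ => by split_ifs <;> simp
  have hinr : ∀ l : Fin n, (∑ i, g (C.edge1 i) • neRow lam lam' (C.edge1 i) +
      ∑ i, g (C.edge2 i) • neRow lam lam' (C.edge2 i)) (Sum.inr l) =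
      ∑ i, if l = C.col i then -(g (C.edge1 i) * colourWeight lam lam' (C.c1 i) +
        g (C.edge2 i) * colourWeight lam lam' (C.c2 i)) else 0 := by
    intro l
    simp only [Pi.add_apply, Finset.sum_apply, Pi.smul_apply, neRow_inr, smul_eq_mul, mul_ite,
      mul_zero, ← Finset.sum_add_distrib]
    refine Finset.sum_congr rfl fun i _ => ?_
    by_cases h : l = C.col i
    · simp only [edge1, edge2, h, if_true]
      ring
    · simp [edge1, edge2, h]
  constructor
  · intro h
    have hrow : ∀ i, g (C.edge2 i) = -g (C.edge1 (i + 1)) := by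
      intro i
      have hi := hinl (C.row (i + 1))
      simp only [h, Pi.zero_apply, C.rowInj.eq_iff, add_left_inj, Finset.sum_ite_eq,
        Finset.mem_univ, if_true] at hi
      linarith
    refine ⟨hrow, fun i => ?_⟩
    have hi := hinr (C.col i)
    simp only [h, Pi.zero_apply, C.colInj.eq_iff, Finset.sum_ite_eq, Finset.mem_univ,
      if_true] at hi
    rw [hrow] at hi
    linarith
  · rintro ⟨h2, h1⟩
    funext ρ
    rcases ρ with j | l
    · rw [hinl]
      simp [h2]
    · rw [hinr]
      simp [h2, h1]

/-- The coefficients on all braces extending coefficients `a` on the odd edges of the cycle,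
with the value on each even edge opposite to that on the next odd edge. -/
theorem exists_extension (a : Fin (C.k + 1) → ℝ) :
    ∃ g : Brace m n → ℝ, (∀ b ∉ C.edges, g b = 0) ∧ (∀ i, g (C.edge1 i) = a i) ∧
      ∀ i, g (C.edge2 i) = -a (i + 1) := by
  have hinj : Function.Injective (Sum.elim C.edge1 C.edge2) :=
    C.edge1_injective.sumElim C.edge2_injective C.edge1_ne_edge2
  let g := Function.extend (Sum.elim C.edge1 C.edge2) (Sum.elim a fun i => -a (i + 1)) 0
  refine ⟨g, fun b hb => ?_, fun i => hinj.extend_apply _ _ (Sum.inl i),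
    fun i => hinj.extend_apply _ _ (Sum.inr i)⟩
  exact Function.extend_apply' _ _ _ (by rwa [edges, ← Set.Sum.elim_range] at hb)

/-- A dependency between the rows of a cycle that vanishes on an odd edge is trivial. -/
theorem eq_zero_of_edge1_eq_zero {lam lam' : ℝ} (hlam : 0 < lam) (hlam' : 0 < lam')
    {g : Brace m n → ℝ} (hg : ∀ b ∉ C.edges, g b = 0)
    (h : ∑ b, g b • neRow lam lam' b = 0) {i : Fin (C.k + 1)} (hi : g (C.edge1 i) = 0) :
    g = 0 := by
  obtain ⟨h2, h1⟩ := (C.sum_smul_neRow_eq_zero_iff hg).mp h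
  have hall : ∀ j, g (C.edge1 j) = 0 := fun j => cyclic_eq_zero
    (a := fun j => g (C.edge1 j)) (fun _ => colourWeight_ne_zero hlam hlam' _) h1 hi j
  funext b
  by_cases hb : b ∈ C.edges
  · rcases hb with ⟨j, rfl⟩ | ⟨j, rfl⟩
    · exact hall j
    · rw [h2, hall, neg_zero, Pi.zero_apply]
  · exact hg b hb

theorem not_rowsIndep_edges_iff {lam lam' : ℝ} (hlam : 0 < lam) (hlam' : 0 < lam')
    (hne : lam ≠ lam') : ¬RowsIndep m n lam lam' C.edges ↔ C.DepColouring := by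
  rw [DepColouring, ← prod_colourWeight_eq_iff hlam hlam' hne,
    ← exists_cyclic_iff_prod_eq fun _ => colourWeight_ne_zero hlam hlam' _, rowsIndep_iff]
  push Not
  constructor
  · rintro ⟨g, hg, h, h0⟩
    exact ⟨fun i => g (C.edge1 i),
      fun ha => h0 (C.eq_zero_of_edge1_eq_zero hlam hlam' hg h (congrFun ha 0)),
      ((C.sum_smul_neRow_eq_zero_iff hg).mp h).2⟩
  · rintro ⟨a, ha, h⟩
    obtain ⟨g, hg, h1, h2⟩ := C.exists_extension a
    refine ⟨g, hg, (C.sum_smul_neRow_eq_zero_iff hg).mpr ⟨fun i => by rw [h1, h2], fun i => ?_⟩,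
      fun h0 => ha (funext fun i => ?_)⟩
    · rw [h1, h1, h]
    · rw [← h1, h0, Pi.zero_apply, Pi.zero_apply]

theorem rowsIndep_of_ssubset_edges {lam lam' : ℝ} (hlam : 0 < lam) (hlam' : 0 < lam')
    {S : Set (Brace m n)} (hS : S ⊂ C.edges) : RowsIndep m n lam lam' S := by
  rw [rowsIndep_iff]
  intro g hg h
  have hgC : ∀ b ∉ C.edges, g b = 0 := fun b hb => hg b fun hbS => hb (hS.subset hbS)
  obtain ⟨e, he, heS⟩ := Set.exists_of_ssubset hS
  rcases he with ⟨i, rfl⟩ | ⟨i, rfl⟩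
  · exact C.eq_zero_of_edge1_eq_zero hlam hlam' hgC h (hg _ heS)
  · refine C.eq_zero_of_edge1_eq_zero hlam hlam' hgC h (i := i + 1) (neg_eq_zero.mp ?_)
    rw [← ((C.sum_smul_neRow_eq_zero_iff hgC).mp h).1, hg _ heS]

end BCycle

/-- Lemma 3.2: for `λ ≠ λ'`, a cycle of edges in `K²_{m,n}` gives a
circuit of the row matroid of the non-Euclidean stress-sheer matrix `SS_{λ,λ'}(B_max)`
iff its colouring is dependent. -/
theorem statement10 (m n : ℕ) (lam lam' : ℝ) (hlam : 0 < lam) (hlam' : 0 < lam')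
    (hne : lam ≠ lam') (C : BCycle m n) :
    IsCircuit m n lam lam' C.edges ↔ C.DepColouring :=
  (and_iff_left fun _ hS => C.rowsIndep_of_ssubset_edges hlam hlam' hS).trans
    (C.not_rowsIndep_edges_iff hlam hlam' hne)
end

section
/- Let n ≥ 1 and let λ_1,…,λ_{2n} be nonzero real numbers. Let A be the 2n×2n real matrix whose entries are all zero except that, for 1 ≤ i ≤ n, rows 2i−1 and 2i each have entry 1 in column i, and, indexing rows cyclically, for each j the row j has entry λ_j in column n + c(j), where c(2i) = c(2i+1) = (i mod n) + 1 for 1 ≤ i ≤ n (so that c(1) = c(2n) = 1). Then A is singular if and only if λ_1·λ_3·…·λ_{2n−1} = λ_2·λ_4·…·λ_{2n}. -/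
open Asymptotics

/-- Telescoping a first-order linear recurrence. -/
theorem mul_prod_range_of_recurrence {R : Type*} [CommRing R] {a b y : ℕ → R} {k : ℕ}
    (h : ∀ i < k, a i * y i = b i * y (i + 1)) :
    y k * ∏ i ∈ Finset.range k, b i = y 0 * ∏ i ∈ Finset.range k, a i := by
  induction k with
  | zero => simp
  | succ k ih =>
    have hk := h k k.lt_succ_self
    have ih := ih fun i hi => h i (hi.trans k.lt_succ_self)
    rw [Finset.prod_range_succ, Finset.prod_range_succ]
    linear_combination a k * ih - (∏ i ∈ Finset.range k, b i) * hk

/-- A cyclic first-order linear recurrence with nonzero coefficients has a nonzero solution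
if and only if the products of the coefficients on both sides agree. -/
theorem exists_cyclic_recurrence_iff {K : Type*} [Field K] {n : ℕ} (hn : 0 < n) {a b : ℕ → K}
    (hb : ∀ i, b i ≠ 0) :
    (∃ y : ℕ → K, (∃ i < n, y i ≠ 0) ∧ ∀ i < n, a i * y i = b i * y ((i + 1) % n)) ↔
      ∏ i ∈ Finset.range n, a i = ∏ i ∈ Finset.range n, b i := by
  constructor
  · rintro ⟨y, ⟨k, hk, hyk⟩, hy⟩
    have key : ∀ k ≤ n, y (k % n) * ∏ i ∈ Finset.range k, b i =
        y 0 * ∏ i ∈ Finset.range k, a i := fun k hk => by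
      have := mul_prod_range_of_recurrence (a := a) (b := b) (y := fun i => y (i % n)) (k := k)
        fun i hi => by simpa [Nat.mod_eq_of_lt (hi.trans_le hk)] using hy i (hi.trans_le hk)
      simpa using this
    have hy0 : y 0 ≠ 0 := fun h0 => by
      have := key k hk.le
      rw [Nat.mod_eq_of_lt hk, h0, zero_mul] at this
      exact mul_ne_zero hyk (Finset.prod_ne_zero_iff.2 fun i _ => hb i) this
    have := key n le_rfl
    rw [Nat.mod_self] at this
    exact (mul_left_cancel₀ hy0 this).symm
  · intro h
    refine ⟨fun k => ∏ i ∈ Finset.range k, a i / b i, ⟨0, hn, by simp⟩, fun i hi => ?_⟩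
    have hstep : a i * ∏ j ∈ Finset.range i, a j / b j =
        b i * ∏ j ∈ Finset.range (i + 1), a j / b j := by
      rw [Finset.prod_range_succ]
      field_simp [hb i]
    rcases Nat.lt_or_ge (i + 1) n with hin | hin
    · simpa only [Nat.mod_eq_of_lt hin] using hstep
    · obtain rfl : n = i + 1 := by omega
      have hprod : ∏ j ∈ Finset.range (i + 1), a j / b j = 1 := by
        rw [Finset.prod_div_distrib, h,
          div_self (Finset.prod_ne_zero_iff.2 fun i _ => hb i)]
      simp only [hstep, hprod, Nat.mod_self, Finset.prod_range_zero]

/-- the determinantal identity for a coloured `2n`-cycle. The `2n × 2n`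
matrix whose rows `2i-1, 2i` (1-indexed) have entry `1` in column `i`, and whose row `j`
has entry `λ_j` in column `n + ⌈j/2⌉ (mod n)`, is singular iff the product of the
odd-indexed `λ`'s equals the product of the even-indexed `λ`'s. -/
theorem statement11 (n : ℕ) (hn : 1 ≤ n) (lam : Fin (2 * n) → ℝ)
    (hlam : ∀ j, lam j ≠ 0) :
    (Matrix.of fun j c : Fin (2 * n) =>
        (if (c : ℕ) = (j : ℕ) / 2 then (1 : ℝ) else 0) +
          (if (c : ℕ) = n + ((j : ℕ) + 1) / 2 % n then lam j else 0)).det = 0 ↔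
      (∏ i : Fin n, lam ⟨2 * (i : ℕ), by have := i.2; omega⟩) =
        ∏ i : Fin n, lam ⟨2 * (i : ℕ) + 1, by have := i.2; omega⟩ := by
  obtain ⟨L, hL, hL0⟩ : ∃ L : ℕ → ℝ, (∀ j : Fin (2 * n), L j = lam j) ∧ ∀ j, L j ≠ 0 := by
    refine ⟨fun j => if h : j < 2 * n then lam ⟨j, h⟩ else 1, fun j => by simp, fun j => ?_⟩
    dsimp only
    split_ifs
    exacts [hlam _, one_ne_zero]
  simp only [← hL]
  rw [← Finset.prod_range fun i => L (2 * i), ← Finset.prod_range fun i => L (2 * i + 1),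
    ← exists_cyclic_recurrence_iff hn fun i => hL0 _, ← Matrix.exists_mulVec_eq_zero_iff]
  have hrow : ∀ (v : Fin (2 * n) → ℝ) (V : ℕ → ℝ) (_ : ∀ j, v j = V j) (j : Fin (2 * n)),
      (Matrix.mulVec (Matrix.of fun j c : Fin (2 * n) =>
        (if (c : ℕ) = (j : ℕ) / 2 then (1 : ℝ) else 0) +
          (if (c : ℕ) = n + ((j : ℕ) + 1) / 2 % n then L j else 0)) v) j =
        V (j / 2) + L j * V (n + (j + 1) / 2 % n) := by
    intro v V hV j
    have h1 : (j : ℕ) / 2 < 2 * n := by omega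
    have h2 : n + ((j : ℕ) + 1) / 2 % n < 2 * n := by
      have := Nat.mod_lt (((j : ℕ) + 1) / 2) hn
      omega
    have e1 : ∀ c : Fin (2 * n), (c : ℕ) = (j : ℕ) / 2 ↔ c = ⟨_, h1⟩ :=
      fun c => by simp [Fin.ext_iff]
    have e2 : ∀ c : Fin (2 * n), (c : ℕ) = n + ((j : ℕ) + 1) / 2 % n ↔ c = ⟨_, h2⟩ :=
      fun c => by simp [Fin.ext_iff]
    simp only [Matrix.mulVec, dotProduct, Matrix.of_apply, e1, e2, add_mul, ite_mul, one_mul,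
      zero_mul, Finset.sum_add_distrib, Finset.sum_ite_eq', Finset.mem_univ,
      if_true, hV]
  constructor
  · rintro ⟨v, hv0, hv⟩
    obtain ⟨V, hV⟩ : ∃ V : ℕ → ℝ, ∀ j, v j = V j :=
      ⟨fun j => if h : j < 2 * n then v ⟨j, h⟩ else 0, fun j => by simp⟩
    have heq : ∀ j < 2 * n, V (j / 2) + L j * V (n + (j + 1) / 2 % n) = 0 := fun j hj => by
      rw [← hrow v V hV ⟨j, hj⟩, hv, Pi.zero_apply]
    have heven : ∀ i < n, V i + L (2 * i) * V (n + i) = 0 := fun i hi => by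
      have := heq (2 * i) (by omega)
      rwa [show 2 * i / 2 = i by omega, show (2 * i + 1) / 2 = i by omega,
        Nat.mod_eq_of_lt hi] at this
    refine ⟨fun i => V (n + i), ?_, fun i hi => ?_⟩
    · by_contra! hy
      refine hv0 (funext fun j => ?_)
      rw [hV, Pi.zero_apply]
      rcases Nat.lt_or_ge j n with hj | hj
      · simpa [hy j hj] using heven j hj
      · simpa [Nat.add_sub_cancel' hj] using hy (j - n) (by omega)
    · have hodd := heq (2 * i + 1) (by omega)
      rw [show (2 * i + 1) / 2 = i by omega, show (2 * i + 1 + 1) / 2 = i + 1 by omega] at hodd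
      linear_combination heven i hi - hodd
  · rintro ⟨y, ⟨k, hk, hyk⟩, hy⟩
    refine ⟨fun j => if (j : ℕ) < n then -L (2 * j) * y j else y (j - n), fun h0 => ?_,
      funext fun j => ?_⟩
    · have := congrFun h0 ⟨n + k, by omega⟩
      simp [hyk] at this
    · rw [hrow _ (fun j => if j < n then -L (2 * j) * y j else y (j - n)) (fun _ => rfl)]
      have hj : (j : ℕ) / 2 < n := by omega
      simp only [hj, if_true, Nat.not_lt.2 (Nat.le_add_right n _), if_false,
        Nat.add_sub_cancel_left, Pi.zero_apply]
      rcases Nat.even_or_odd' (j : ℕ) with ⟨i, hi | hi⟩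
      · rw [show (j : ℕ) / 2 = i by omega, show ((j : ℕ) + 1) / 2 = i by omega, hi,
          Nat.mod_eq_of_lt (by omega)]
        ring
      · rw [show (j : ℕ) / 2 = i by omega, show ((j : ℕ) + 1) / 2 = i + 1 by omega, hi]
        linear_combination -hy i (by omega)
end

section
/- Let ‖·‖ be a differentiable, strictly convex norm on ℝ² that is not a scalar multiple of the Euclidean norm, let α ∈ [0,π/2), and let G(B) be an m×n braced grid of inclination α whose brace parameters λ, λ′ satisfy λ ≠ λ′. Then G(B) is infinitesimally rigid in (ℝ²,‖·‖) if and only if the rank of the non-Euclidean stress-sheer matrix SS_{λ,λ′}(B) equals m+n. -/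
open Asymptotics

/-- The cross product (signed area) of two plane vectors. -/
def cross (v w : V2) : ℝ := v.1 * w.2 - v.2 * w.1

lemma exists_eq_combination {v w : V2} (h : cross v w ≠ 0) (z : V2) :
    ∃ a b : ℝ, z = a • v + b • w := by
  refine ⟨cross z w / cross v w, cross v z / cross v w, ?_⟩
  ext
  · simp only [Prod.fst_add, Prod.smul_fst, smul_eq_mul]
    field_simp
    simp only [cross]
    ring
  · simp only [Prod.snd_add, Prod.smul_snd, smul_eq_mul]
    field_simp
    simp only [cross]
    ring

lemma combination_injective {v w : V2} (h : cross v w ≠ 0) {a b a' b' : ℝ}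
    (hab : a • v + b • w = a' • v + b' • w) : a = a' ∧ b = b' := by
  obtain ⟨h1, h2⟩ := Prod.ext_iff.mp hab
  simp only [Prod.fst_add, Prod.smul_fst, Prod.snd_add, Prod.smul_snd, smul_eq_mul] at h1 h2
  constructor <;> apply mul_right_cancel₀ h <;> simp only [cross]
  · linear_combination w.2 * h1 - w.1 * h2
  · linear_combination v.1 * h2 - v.2 * h1

lemma exists_smul_of_cross_eq_zero {v w : V2} (hv : v ≠ 0) (h : cross v w = 0) :
    ∃ c : ℝ, w = c • v := by
  unfold cross at h
  by_cases h1 : v.1 = 0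
  · have h2 : v.2 ≠ 0 := fun h2 => hv (Prod.ext h1 h2)
    have hw : w.1 = 0 := by simpa [h1, h2] using h
    exact ⟨w.2 / v.2, Prod.ext (by simp [h1, hw]) (by simp [h2])⟩
  · refine ⟨w.1 / v.1, Prod.ext (by simp [h1]) ?_⟩
    simp only [Prod.smul_snd, smul_eq_mul]
    field_simp
    linear_combination h

/-- A nonzero functional on the plane vanishing on `x • v + y • w ≠ 0` vanishes exactly on the
multiples of that vector. -/
lemma functional_combination_eq_zero_iff {L : V2 →L[ℝ] ℝ} (hL : ∃ z, L z ≠ 0) {v w : V2}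
    (h : cross v w ≠ 0) {x y : ℝ} (hxy : x ≠ 0 ∨ y ≠ 0) (h0 : L (x • v + y • w) = 0) (a b : ℝ) :
    L (a • v + b • w) = 0 ↔ a * y = b * x := by
  simp only [map_add, map_smul, smul_eq_mul] at h0 ⊢
  have hne : L v ≠ 0 ∨ L w ≠ 0 := by
    by_contra! hc
    obtain ⟨z, hz⟩ := hL
    obtain ⟨c, d, rfl⟩ := exists_eq_combination h z
    simp [hc.1, hc.2] at hz
  constructor
  · intro h1
    rcases hne with hv | hw
    · apply mul_right_cancel₀ hv
      linear_combination y * h1 - b * h0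
    · apply mul_right_cancel₀ hw
      linear_combination a * h0 - x * h1
  · intro h1
    rcases hxy with hx | hy
    · apply mul_left_cancel₀ hx
      linear_combination a * h0 - L w * h1
    · apply mul_left_cancel₀ hy
      linear_combination b * h0 + L v * h1

section NormDerivative

variable {ν : V2 → ℝ}

lemma IsNormFn.nonneg (hν : IsNormFn ν) (v : V2) : 0 ≤ ν v := by
  have h := hν.2.2 v ((-1 : ℝ) • v)
  rw [hν.2.1, neg_one_smul, add_neg_cancel, (hν.1 0).2 rfl] at h
  norm_num at h
  linarith

lemma hasDerivAt_along (hd : SmoothNorm ν) {p : V2} (hp : p ≠ 0) (w : V2) :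
    HasDerivAt (fun t : ℝ => ν (p + t • w)) (fderiv ℝ ν p w) 0 := by
  have h1 : HasDerivAt (fun t : ℝ => p + t • w) w 0 := by
    simpa using ((hasDerivAt_id (0 : ℝ)).smul_const w).const_add p
  have h2 : HasFDerivAt ν (fderiv ℝ ν p) (p + (0 : ℝ) • w) := by
    simpa using (hd p hp).hasFDerivAt
  exact h2.comp_hasDerivAt 0 h1

lemma isLittleO_iff_fderiv_eq_zero (hd : SmoothNorm ν) {p : V2} (hp : p ≠ 0) (w : V2) :
    (fun t : ℝ => ν (p + t • w) - ν p) =o[nhdsWithin 0 (Set.Ioi 0)] (id : ℝ → ℝ) ↔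
      fderiv ℝ ν p w = 0 := by
  have key : (fun t : ℝ => ν (p + t • w) - ν p) =o[nhdsWithin 0 (Set.Ioi 0)] (id : ℝ → ℝ) ↔
      HasDerivWithinAt (fun t : ℝ => ν (p + t • w)) 0 (Set.Ioi 0) 0 := by
    rw [hasDerivWithinAt_iff_isLittleO]
    simp only [zero_smul, add_zero, sub_zero, smul_zero]
    rfl
  have hder := (hasDerivAt_along hd hp w).hasDerivWithinAt (s := Set.Ioi 0)
  rw [key]
  constructor
  · exact fun h => (uniqueDiffWithinAt_Ioi (0 : ℝ)).eq_deriv _ hder h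
  · exact fun h => h ▸ hder

lemma fderiv_smul_eq_zero_iff (hν : IsNormFn ν) (hd : SmoothNorm ν) {p : V2} (hp : p ≠ 0)
    {c : ℝ} (hc : c ≠ 0) (w : V2) : fderiv ℝ ν (c • p) w = 0 ↔ fderiv ℝ ν p w = 0 := by
  have h1 := hasDerivAt_along hd (smul_ne_zero hc hp) (c • w)
  have h2 := (hasDerivAt_along hd hp w).const_mul |c|
  have heq : (fun t : ℝ => ν (c • p + t • c • w)) = fun t => |c| * ν (p + t • w) := by
    funext t
    rw [← hν.2.1, smul_add, smul_comm c t w]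
  rw [heq] at h1
  have h3 := h1.unique h2
  rw [map_smul, smul_eq_mul] at h3
  constructor
  · intro h
    rw [h, mul_zero] at h3
    simpa [hc] using h3.symm
  · intro h
    rw [h, mul_zero] at h3
    simpa [hc] using h3

lemma fderiv_self (hν : IsNormFn ν) (hd : SmoothNorm ν) {p : V2} (hp : p ≠ 0) :
    fderiv ℝ ν p p = ν p := by
  have h1 := hasDerivAt_along hd hp p
  have h2 : HasDerivAt (fun t : ℝ => (1 + t) * ν p) (ν p) 0 := by
    simpa using ((hasDerivAt_id (0 : ℝ)).const_add 1).mul_const (ν p)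
  refine h1.unique (h2.congr_of_eventuallyEq ?_)
  filter_upwards [lt_mem_nhds (show (-1 : ℝ) < 0 by norm_num)] with t ht
  have : p + t • p = (1 + t) • p := by rw [add_smul, one_smul]
  rw [this, hν.2.1, abs_of_pos (by linarith)]

lemma fderiv_le (hν : IsNormFn ν) (hd : SmoothNorm ν) {p : V2} (hp : p ≠ 0) (w : V2) :
    fderiv ℝ ν p w ≤ ν w := by
  have h := (hasDerivAt_along hd hp w).hasDerivWithinAt (s := Set.Ioi 0)
  rw [hasDerivWithinAt_iff_tendsto_slope' (by simp)] at h
  refine le_of_tendsto h ?_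
  filter_upwards [self_mem_nhdsWithin] with t ht
  have ht : 0 < t := ht
  rw [slope_def_field, zero_smul, add_zero, sub_zero, div_le_iff₀ ht]
  have h1 := hν.2.2 p (t • w)
  rw [hν.2.1, abs_of_pos ht] at h1
  linarith

lemma abs_fderiv_le (hν : IsNormFn ν) (hd : SmoothNorm ν) {p : V2} (hp : p ≠ 0) (w : V2) :
    |fderiv ℝ ν p w| ≤ ν w := by
  have h := fderiv_le hν hd hp ((-1 : ℝ) • w)
  rw [map_smul, hν.2.1, smul_eq_mul] at h
  norm_num at h
  exact abs_le.2 ⟨by linarith, fderiv_le hν hd hp w⟩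

lemma IsNormFn.ne_zero_of_eq_one (hν : IsNormFn ν) {p : V2} (hp : ν p = 1) : p ≠ 0 := by
  rintro rfl
  rw [(hν.1 0).2 rfl] at hp
  exact zero_ne_one hp

lemma eq_of_fderiv_eq_one (hν : IsNormFn ν) (hd : SmoothNorm ν) (hs : StrictlyConvexNorm ν)
    {p q : V2} (hp : ν p = 1) (hq : ν q = 1) (h : fderiv ℝ ν p q = 1) : p = q := by
  by_contra hne
  have hp0 := hν.ne_zero_of_eq_one hp
  have h1 := hs p q hp hq hne
  have h2 := fderiv_le hν hd hp0 ((1 / 2 : ℝ) • (p + q))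
  rw [map_smul, map_add, h, fderiv_self hν hd hp0, hp, smul_eq_mul] at h2
  linarith

/-- Points of the unit sphere of a smooth strictly convex norm with a common tangent direction
are equal or antipodal. -/
lemma eq_or_eq_neg_of_common_tangent (hν : IsNormFn ν) (hd : SmoothNorm ν)
    (hs : StrictlyConvexNorm ν) {p q w : V2} (hp : ν p = 1) (hq : ν q = 1) (hw : w ≠ 0)
    (hpw : IsTangentAt ν p w) (hqw : IsTangentAt ν q w) : p = q ∨ p = -q := by
  have hp0 := hν.ne_zero_of_eq_one hp
  have hq0 := hν.ne_zero_of_eq_one hq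
  have hpp := fderiv_self hν hd hp0
  have hqq := fderiv_self hν hd hq0
  have hcr : cross w q ≠ 0 := by
    intro hc
    obtain ⟨c, hc⟩ := exists_smul_of_cross_eq_zero hw hc
    have : fderiv ℝ ν q q = c * fderiv ℝ ν q w := by
      conv_lhs => rw [hc, map_smul, smul_eq_mul, ← hc]
    rw [hqq, hq, hqw, mul_zero] at this
    exact one_ne_zero this
  obtain ⟨x, y, hxy⟩ := exists_eq_combination hcr p
  have h1 : y * fderiv ℝ ν p q = 1 := by
    rw [hp] at hpp
    rw [← hpp]
    have h := congrArg (fderiv ℝ ν p) hxy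
    rw [map_add, map_smul, map_smul, hpw, smul_zero, zero_add, smul_eq_mul] at h
    exact h.symm
  have h2 : fderiv ℝ ν q p = y := by
    rw [hxy, map_add, map_smul, map_smul, hqw, hqq, hq]
    simp
  have hy := abs_le.1 (hp ▸ h2 ▸ abs_fderiv_le hν hd hq0 p)
  have hf := abs_le.1 (hq ▸ abs_fderiv_le hν hd hp0 q)
  rcases le_total 0 y with h0 | h0
  · left
    exact eq_of_fderiv_eq_one hν hd hs hp hq (by nlinarith)
  · right
    refine eq_of_fderiv_eq_one hν hd hs hp ?_ ?_
    · rw [← neg_one_smul ℝ q, hν.2.1, hq]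
      norm_num
    · rw [map_neg]
      nlinarith

lemma direction_ne_zero (θ : ℝ) : ((Real.cos θ, Real.sin θ) : V2) ≠ 0 := by
  intro h
  obtain ⟨h1, h2⟩ := Prod.ext_iff.mp h
  have := Real.sin_sq_add_cos_sq θ
  simp only [Prod.fst_zero, Prod.snd_zero] at h1 h2
  rw [h1, h2] at this
  norm_num at this

lemma norm_direction_pos (hν : IsNormFn ν) (θ : ℝ) : 0 < ν (Real.cos θ, Real.sin θ) :=
  lt_of_le_of_ne (hν.nonneg _) fun h => direction_ne_zero θ ((hν.1 _).1 h.symm)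

lemma norm_sphPt (hν : IsNormFn ν) (θ : ℝ) : ν (sphPt ν θ) = 1 := by
  have h := norm_direction_pos hν θ
  rw [sphPt, hν.2.1, abs_of_pos (inv_pos.2 h), inv_mul_cancel₀ h.ne']

lemma cross_tangents_ne_zero (hν : IsNormFn ν) (hd : SmoothNorm ν) (hs : StrictlyConvexNorm ν)
    {α : ℝ} {ux uy : V2} (hux : IsPosUnitTangent ν α ux)
    (huy : IsPosUnitTangent ν (α + Real.pi / 2) uy) : cross ux uy ≠ 0 := by
  intro hc
  have hux0 := hν.ne_zero_of_eq_one hux.1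
  have huy0 := hν.ne_zero_of_eq_one huy.1
  obtain ⟨c, rfl⟩ := exists_smul_of_cross_eq_zero hux0 hc
  have hc0 : c ≠ 0 := (smul_ne_zero_iff.1 huy0).1
  have ht : IsTangentAt ν (sphPt ν (α + Real.pi / 2)) ux := by
    have h := huy.2.1
    rw [IsTangentAt, map_smul, smul_eq_mul] at h
    exact (mul_eq_zero.1 h).resolve_left hc0
  have hpos := norm_direction_pos hν α
  have hpos' := norm_direction_pos hν (α + Real.pi / 2)
  have hcross : cross (sphPt ν α) (sphPt ν (α + Real.pi / 2)) ≠ 0 := by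
    have : cross (sphPt ν α) (sphPt ν (α + Real.pi / 2)) =
        (ν (Real.cos α, Real.sin α))⁻¹ *
          (ν (Real.cos (α + Real.pi / 2), Real.sin (α + Real.pi / 2)))⁻¹ := by
      simp only [cross, sphPt, Prod.smul_fst, Prod.smul_snd, smul_eq_mul]
      rw [Real.cos_add_pi_div_two, Real.sin_add_pi_div_two]
      linear_combination (ν (Real.cos α, Real.sin α))⁻¹ *
        (ν (-Real.sin α, Real.cos α))⁻¹ * Real.sin_sq_add_cos_sq α
    rw [this]
    positivity
  rcases eq_or_eq_neg_of_common_tangent hν hd hs (norm_sphPt hν α)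
    (norm_sphPt hν (α + Real.pi / 2)) hux0 hux.2.1 ht with h | h <;>
  · apply hcross
    rw [h]
    simp only [cross, Prod.fst_neg, Prod.snd_neg]
    ring

/-- The infinitesimal flex condition for a bar in the direction `±θ`, in the coordinates of a
basis `ux`, `uy` in which `(x, y)` is tangent to the unit sphere at its point in direction `θ`. -/
lemma bar_flex_iff (hν : IsNormFn ν) (hd : SmoothNorm ν) {ux uy : V2} (hcr : cross ux uy ≠ 0)
    {θ x y : ℝ} (hxy : x ≠ 0 ∨ y ≠ 0) (ht : IsTangentAt ν (sphPt ν θ) (x • ux + y • uy))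
    {p q : V2} {r : ℝ} (hr : r ≠ 0) (hpq : p - q = r • ((Real.cos θ, Real.sin θ) : V2))
    (a b a' b' : ℝ) :
    (fun t : ℝ => ν (p + t • (a • ux + b • uy) - (q + t • (a' • ux + b' • uy))) - ν (p - q))
      =o[nhdsWithin 0 (Set.Ioi 0)] (id : ℝ → ℝ) ↔ (a - a') * y = (b - b') * x := by
  have hpq0 : p - q ≠ 0 := hpq ▸ smul_ne_zero hr (direction_ne_zero θ)
  have hs1 := norm_sphPt hν θ
  have hs0 := hν.ne_zero_of_eq_one hs1
  have hpos := norm_direction_pos hν θ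
  have hpq' : p - q = (r * ν (Real.cos θ, Real.sin θ)) • sphPt ν θ := by
    rw [hpq, sphPt, smul_smul, mul_assoc, mul_inv_cancel₀ hpos.ne', mul_one]
  have heq : (fun t : ℝ =>
      ν (p + t • (a • ux + b • uy) - (q + t • (a' • ux + b' • uy))) - ν (p - q)) =
      fun t : ℝ => ν ((p - q) + t • ((a - a') • ux + (b - b') • uy)) - ν (p - q) := by
    funext t
    congr 2
    module
  rw [heq, isLittleO_iff_fderiv_eq_zero hd hpq0, hpq',
    fderiv_smul_eq_zero_iff hν hd hs0 (mul_ne_zero hr hpos.ne'),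
    functional_combination_eq_zero_iff ⟨sphPt ν θ, ?_⟩ hcr hxy ht]
  rw [fderiv_self hν hd hs0, hs1]
  exact one_ne_zero

end NormDerivative

section Grid

variable {m n : ℕ}

/-- Infinitesimal flexes of a braced grid in the coordinates of the basis `ux`, `uy`. -/
lemma isFlex_bracedGrid_iff {ν : V2 → ℝ} (hν : IsNormFn ν) (hd : SmoothNorm ν) {α : ℝ}
    {ux uy : V2} (hcr : cross ux uy ≠ 0) (hux : IsTangentAt ν (sphPt ν α) ux)
    (huy : IsTangentAt ν (sphPt ν (α + Real.pi / 2)) uy) {lam lam' : ℝ}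
    (htb : IsTangentAt ν (sphPt ν (α + Real.pi / 4)) (lam • ux + uy))
    (htb' : IsTangentAt ν (sphPt ν (α + 3 * Real.pi / 4)) (-lam' • ux + uy))
    (B : Set (Brace m n)) (a b : Joint m n → ℝ) :
    IsFlex ν (bracedGrid m n α B) (fun v => a v • ux + b v • uy) ↔
      (∀ (j : Fin m) (k : Fin (n + 1)), b (j.succ, k) = b (j.castSucc, k)) ∧
      (∀ (j : Fin (m + 1)) (k : Fin n), a (j, k.succ) = a (j, k.castSucc)) ∧
      ∀ e ∈ B, if e.2.2 then
          a (e.1.succ, e.2.1.succ) - a (e.1.castSucc, e.2.1.castSucc) =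
            lam * (b (e.1.succ, e.2.1.succ) - b (e.1.castSucc, e.2.1.castSucc))
        else
          a (e.1.succ, e.2.1.castSucc) - a (e.1.castSucc, e.2.1.succ) =
            lam' * (b (e.1.castSucc, e.2.1.succ) - b (e.1.succ, e.2.1.castSucc)) := by
  have hsq : Real.sqrt 2 * Real.sqrt 2 = 2 := Real.mul_self_sqrt (by norm_num)
  have hs0 : Real.sqrt 2 ≠ 0 := by positivity
  have hx : IsTangentAt ν (sphPt ν α) ((1 : ℝ) • ux + (0 : ℝ) • uy) := by simpa using hux
  have hy : IsTangentAt ν (sphPt ν (α + Real.pi / 2)) ((0 : ℝ) • ux + (1 : ℝ) • uy) := by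
    simpa using huy
  have hb : IsTangentAt ν (sphPt ν (α + Real.pi / 4)) (lam • ux + (1 : ℝ) • uy) := by
    simpa using htb
  have hb' : IsTangentAt ν (sphPt ν (α + 3 * Real.pi / 4)) (-lam' • ux + (1 : ℝ) • uy) := by
    simpa using htb'
  have horizontal (j : Fin m) (k : Fin (n + 1)) := bar_flex_iff hν hd hcr (by simp) hx
    (p := rotv α ((j.castSucc : ℕ), (k : ℕ))) (q := rotv α ((j.succ : ℕ), (k : ℕ))) (r := -1)
    (by norm_num) (by ext <;> simp [rotv] <;> ring)
    (a (j.castSucc, k)) (b (j.castSucc, k)) (a (j.succ, k)) (b (j.succ, k))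
  have vertical (j : Fin (m + 1)) (k : Fin n) := bar_flex_iff hν hd hcr (by simp) hy
    (p := rotv α ((j : ℕ), (k.castSucc : ℕ))) (q := rotv α ((j : ℕ), (k.succ : ℕ))) (r := -1)
    (by norm_num)
    (by ext <;> simp [rotv, Real.cos_add_pi_div_two, Real.sin_add_pi_div_two] <;> ring)
    (a (j, k.castSucc)) (b (j, k.castSucc)) (a (j, k.succ)) (b (j, k.succ))
  have blue (j : Fin m) (k : Fin n) := bar_flex_iff hν hd hcr (by simp) hb
    (p := rotv α ((j.castSucc : ℕ), (k.castSucc : ℕ)))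
    (q := rotv α ((j.succ : ℕ), (k.succ : ℕ))) (r := -Real.sqrt 2)
    (by simp)
    (by
      ext <;> simp [rotv, Real.cos_add, Real.sin_add]
      · linear_combination (Real.sin α - Real.cos α) / 2 * (-hsq)
      · linear_combination (Real.sin α + Real.cos α) / 2 * hsq)
    (a (j.castSucc, k.castSucc)) (b (j.castSucc, k.castSucc)) (a (j.succ, k.succ))
    (b (j.succ, k.succ))
  have angle : α + 3 * Real.pi / 4 = α + Real.pi / 4 + Real.pi / 2 := by ring
  have red (j : Fin m) (k : Fin n) := bar_flex_iff hν hd hcr (by simp) hb'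
    (p := rotv α ((j.succ : ℕ), (k.castSucc : ℕ)))
    (q := rotv α ((j.castSucc : ℕ), (k.succ : ℕ))) (r := -Real.sqrt 2)
    (by simp)
    (by
      rw [angle, Real.cos_add_pi_div_two, Real.sin_add_pi_div_two]
      ext <;> simp [rotv, Real.cos_add, Real.sin_add]
      · linear_combination (Real.sin α + Real.cos α) / 2 * (-hsq)
      · linear_combination (Real.cos α - Real.sin α) / 2 * hsq)
    (a (j.succ, k.castSucc)) (b (j.succ, k.castSucc)) (a (j.castSucc, k.succ))
    (b (j.castSucc, k.succ))
  constructor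
  · intro h
    refine ⟨fun j k => ?_, fun j k => ?_, ?_⟩
    · have := (horizontal j k).1 (h ((j.castSucc, k), (j.succ, k)) (Or.inl (Or.inl (by simp))))
      linarith
    · have := (vertical j k).1 (h ((j, k.castSucc), (j, k.succ)) (Or.inl (Or.inr (by simp))))
      linarith
    · rintro ⟨j, k, c⟩ he
      have hbar := h _ (Or.inr ⟨_, he, rfl⟩)
      cases c
      · have := (red j k).1 hbar
        simp only [Bool.false_eq_true, if_false]
        linarith
      · have := (blue j k).1 hbar
        simp only [if_true]
        linarith
  · rintro ⟨h1, h2, h3⟩ e (he | he)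
    · obtain ⟨⟨j, k⟩, ⟨j', k'⟩⟩ := e
      rcases he with ⟨hj, hk⟩ | ⟨hj, hk⟩
      · obtain rfl : k = k' := hk
        obtain ⟨i, rfl, rfl⟩ : ∃ i : Fin m, j = i.castSucc ∧ j' = i.succ :=
          ⟨⟨j, by have := j'.2; simp at hj; omega⟩, rfl, Fin.ext hj.symm⟩
        exact (horizontal i k).2 (by linarith [h1 i k])
      · obtain rfl : j = j' := hj
        obtain ⟨i, rfl, rfl⟩ : ∃ i : Fin n, k = i.castSucc ∧ k' = i.succ :=
          ⟨⟨k, by have := k'.2; simp at hk; omega⟩, rfl, Fin.ext hk.symm⟩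
        exact (vertical j i).2 (by linarith [h2 j i])
    · obtain ⟨⟨j, k, c⟩, he, rfl⟩ := he
      have hbar := h3 _ he
      cases c
      · simp only [Bool.false_eq_true, if_false] at hbar
        exact (red j k).2 (by linarith)
      · simp only [if_true] at hbar
        exact (blue j k).2 (by linarith)

lemma Fin.apply_eq_apply_zero_of_succ_eq {N : ℕ} {f : Fin (N + 1) → ℝ}
    (h : ∀ i : Fin N, f i.succ = f i.castSucc) (i : Fin (N + 1)) : f i = f 0 := by
  induction i using Fin.induction with
  | zero => rfl
  | succ i ih => rw [h, ih]

lemma rank_eq_card_iff_mulVec {ι κ : Type*} [Fintype ι] [Fintype κ] (A : Matrix ι κ ℝ) :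
    A.rank = Fintype.card κ ↔ ∀ x, A.mulVec x = 0 → x = 0 := by
  classical
  have h := A.mulVecLin.finrank_range_add_finrank_ker
  rw [Module.finrank_fintype_fun_eq_card] at h
  have hk : Module.finrank ℝ (LinearMap.ker A.mulVecLin) = 0 ↔ ∀ x, A.mulVec x = 0 → x = 0 := by
    rw [Submodule.finrank_eq_zero, LinearMap.ker_eq_bot']
    simp
  rw [← hk, Matrix.rank]
  omega

lemma sum_neRow_mul (lam lam' : ℝ) (e : Brace m n) (x : RibbonIdx m n → ℝ) :
    ∑ ρ, neRow lam lam' e ρ * x ρ =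
      x (Sum.inl e.1) - (if e.2.2 then lam else lam') * x (Sum.inr e.2.1) := by
  rw [Fintype.sum_sum_type]
  simp only [neRow, ite_mul, one_mul, zero_mul, Finset.sum_ite_eq',
    Finset.mem_univ, if_true]
  split_ifs <;> ring

end Grid

/-- Lemma 3.4: for a differentiable, strictly convex, non-Euclidean
norm and inclination `α` with distinct brace parameters `λ ≠ λ'`, the braced grid `G(B)`
is infinitesimally rigid iff the non-Euclidean stress-sheer matrix `SS_{λ,λ'}(B)` has
rank `m + n`. -/
theorem statement13 (m n : ℕ) (hm : 1 ≤ m) (hn : 1 ≤ n) (ν : V2 → ℝ)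
    (hnorm : IsNormFn ν) (hdiff : SmoothNorm ν) (hconv : StrictlyConvexNorm ν)
    (hnE : NonEuclidean ν) (α : ℝ) (hα0 : 0 ≤ α) (hα1 : α < Real.pi / 2)
    (ux uy : V2)
    (hux : IsPosUnitTangent ν α ux) (huy : IsPosUnitTangent ν (α + Real.pi / 2) uy)
    (lam lam' : ℝ) (hlam : 0 < lam) (hlam' : 0 < lam')
    (htb : IsTangentAt ν (sphPt ν (α + Real.pi / 4)) (lam • ux + uy))
    (htb' : IsTangentAt ν (sphPt ν (α + 3 * Real.pi / 4)) (-lam' • ux + uy))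
    (hne : lam ≠ lam') (B : Finset (Brace m n)) :
    NormRigid ν (bracedGrid m n α ↑B) ↔
      (Matrix.of fun (b : B) (ρ : RibbonIdx m n) => neRow lam lam' (b : Brace m n) ρ).rank
        = m + n := by
  have hcr := cross_tangents_ne_zero hnorm hdiff hconv hux huy
  have hflex := isFlex_bracedGrid_iff hnorm hdiff hcr hux.2.1 huy.2.1 htb htb'
    (B : Set (Brace m n))
  have hcard : m + n = Fintype.card (RibbonIdx m n) := by simp
  have hker (x : RibbonIdx m n → ℝ) :
      (Matrix.of fun (b : B) (ρ : RibbonIdx m n) => neRow lam lam' (b : Brace m n) ρ).mulVec x = 0 ↔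
        ∀ e ∈ B, x (Sum.inl e.1) - (if e.2.2 then lam else lam') * x (Sum.inr e.2.1) = 0 := by
    simp only [funext_iff, Matrix.mulVec, dotProduct, Matrix.of_apply, Pi.zero_apply,
      sum_neRow_mul, Subtype.forall]
  rw [hcard, rank_eq_card_iff_mulVec]
  constructor
  · intro hrigid x hx
    rw [hker] at hx
    let a : Joint m n → ℝ := fun v => Fin.partialSum (fun j => x (Sum.inl j)) v.1
    let b : Joint m n → ℝ := fun v => Fin.partialSum (fun k => x (Sum.inr k)) v.2
    have ha (j : Fin m) (k k' : Fin (n + 1)) :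
        a (j.succ, k) = a (j.castSucc, k') + x (Sum.inl j) := Fin.partialSum_succ _ _
    have hb (j j' : Fin (m + 1)) (k : Fin n) :
        b (j, k.succ) = b (j', k.castSucc) + x (Sum.inr k) := Fin.partialSum_succ _ _
    have hconst := hrigid _ ((hflex a b).2 ⟨fun _ _ => rfl, fun _ _ => rfl, ?_⟩)
    · funext ρ
      rcases ρ with j | k
      · have := (combination_injective hcr (hconst (j.succ, 0) (j.castSucc, 0))).1
        rw [ha j 0 0] at this
        simpa using this
      · have := (combination_injective hcr (hconst (0, k.succ) (0, k.castSucc))).2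
        rw [hb 0 0 k] at this
        simpa using this
    · rintro ⟨j, k, c⟩ he
      have := hx _ he
      cases c
      · simp only [Bool.false_eq_true, if_false] at this ⊢
        rw [ha j k.castSucc k.succ, hb j.castSucc j.succ k]
        linarith
      · simp only [if_true] at this ⊢
        rw [ha j k.succ k.castSucc, hb j.succ j.castSucc k]
        linarith
  · intro hinj u hu
    choose a b hab using fun v => exists_eq_combination hcr (u v)
    obtain rfl : u = fun v => a v • ux + b v • uy := funext hab
    obtain ⟨hb, ha, hbrace⟩ := (hflex a b).1 hu
    have ha' (j k) : a (j, k) = a (j, 0) :=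
      Fin.apply_eq_apply_zero_of_succ_eq (f := fun k => a (j, k)) (ha j) k
    have hb' (j k) : b (j, k) = b (0, k) :=
      Fin.apply_eq_apply_zero_of_succ_eq (f := fun j => b (j, k)) (fun i => hb i k) j
    have hzero := hinj (Sum.elim (fun j => a (j.succ, 0) - a (j.castSucc, 0))
      fun k => b (0, k.succ) - b (0, k.castSucc)) ((hker _).2 ?_)
    · have ha0 (j) : a (j, 0) = a (0, 0) :=
        Fin.apply_eq_apply_zero_of_succ_eq (f := fun j => a (j, 0))
          (fun j => sub_eq_zero.1 (congrFun hzero (Sum.inl j))) j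
      have hb0 (k) : b (0, k) = b (0, 0) :=
        Fin.apply_eq_apply_zero_of_succ_eq (f := fun k => b (0, k))
          (fun k => sub_eq_zero.1 (congrFun hzero (Sum.inr k))) k
      rintro ⟨j, k⟩ ⟨j', k'⟩
      simp only [ha' j k, ha' j' k', ha0 j, ha0 j', hb' j k, hb' j' k', hb0 k, hb0 k']
    · rintro ⟨j, k, c⟩ he
      have := hbrace _ he
      cases c
      · simp only [Bool.false_eq_true, if_false, Sum.elim_inl, Sum.elim_inr] at this ⊢
        rw [ha' j.castSucc k.succ, ha' j.succ k.castSucc, hb' j.castSucc k.succ,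
          hb' j.succ k.castSucc] at this
        linarith
      · simp only [if_true, Sum.elim_inl, Sum.elim_inr] at this ⊢
        rw [ha' j.castSucc k.castSucc, ha' j.succ k.succ, hb' j.castSucc k.castSucc,
          hb' j.succ k.succ] at this
        linarith
end

section
/- An axis-aligned braced m×n grid of squares G(B) is infinitesimally rigid in (ℝ², ‖·‖_∞) if and only if every vertex of its bicoloured braces graph (that is, every row and every column of squares) is incident to at least one blue edge and at least one red edge; equivalently, every ribbon of the grid contains at least one brace of each of the two diagonal types. -/
open Asymptotics

open Filter Topology in
theorem isLittleO_id_iff_of_eventuallyEq_mul {f : ℝ → ℝ} {c : ℝ}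
    (h : ∀ᶠ t in 𝓝[>] (0 : ℝ), f t = c * t) :
    f =o[𝓝[>] (0 : ℝ)] (id : ℝ → ℝ) ↔ c = 0 := by
  rw [isLittleO_congr (g₂ := id) h EventuallyEq.rfl]
  constructor
  · intro hc
    have h1 : Tendsto (fun t : ℝ => c * t / id t) (𝓝[>] 0) (𝓝 0) := hc.tendsto_div_nhds_zero
    have h2 : Tendsto (fun t : ℝ => c * t / id t) (𝓝[>] 0) (𝓝 c) := by
      refine tendsto_const_nhds.congr' ?_
      filter_upwards [self_mem_nhdsWithin] with t ht
      have : t ≠ 0 := ne_of_gt ht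
      simp [this]
    exact tendsto_nhds_unique h2 h1
  · rintro rfl
    exact (isLittleO_zero _ _).congr_left fun t => (zero_mul t).symm

open Filter Topology in
theorem eventually_pos_and_abs_mul_lt (a b : ℝ) :
    ∀ᶠ t in 𝓝[>] (0 : ℝ), 0 < t ∧ |t * a| < 1 / 2 ∧ |t * b| < 1 / 2 := by
  have key (c : ℝ) : ∀ᶠ t in 𝓝[>] (0 : ℝ), |t * c| < 1 / 2 := by
    have : Tendsto (fun t : ℝ => |t * c|) (𝓝 0) (𝓝 |0 * c|) :=
      Continuous.tendsto (by fun_prop) 0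
    rw [zero_mul, abs_zero] at this
    exact nhdsWithin_le_nhds (this.eventually_lt_const (by norm_num))
  filter_upwards [self_mem_nhdsWithin, key a, key b] with t h0 h1 h2
  exact ⟨h0, h1, h2⟩

/-- The flex condition for the sup norm on a bar with direction `d` and relative velocity `w`. -/
def IsSupFlexAlong (d w : V2) : Prop :=
  (fun t : ℝ => supNorm (d + t • w) - supNorm d) =o[nhdsWithin 0 (Set.Ioi 0)] (id : ℝ → ℝ)

theorem isFlex_supNorm_iff {J : Type} (F : Framework J) (u : J → V2) :
    IsFlex supNorm F u ↔
      ∀ e ∈ F.bars, IsSupFlexAlong (F.pos e.1 - F.pos e.2) (u e.1 - u e.2) := by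
  refine forall₂_congr fun e _ => ?_
  have (t : ℝ) : F.pos e.1 + t • u e.1 - (F.pos e.2 + t • u e.2) =
      F.pos e.1 - F.pos e.2 + t • (u e.1 - u e.2) := by
    rw [smul_sub]; abel
  simp only [IsSupFlexAlong, this]

theorem isSupFlexAlong_horizontal (w : V2) : IsSupFlexAlong (-1, 0) w ↔ w.1 = 0 := by
  rw [IsSupFlexAlong, isLittleO_id_iff_of_eventuallyEq_mul (c := -w.1), neg_eq_zero]
  filter_upwards [eventually_pos_and_abs_mul_lt w.1 w.2] with t ht
  obtain ⟨-, h1, h2⟩ := ht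
  have := abs_lt.1 h1
  simp only [supNorm, Prod.fst_add, Prod.snd_add, Prod.smul_fst, Prod.smul_snd, smul_eq_mul,
    abs_neg, abs_one, abs_zero, zero_add]
  rw [abs_of_neg (by linarith : -1 + t * w.1 < 0), max_eq_left (by linarith),
    max_eq_left zero_le_one]
  ring

theorem isSupFlexAlong_vertical (w : V2) : IsSupFlexAlong (0, -1) w ↔ w.2 = 0 := by
  rw [IsSupFlexAlong, isLittleO_id_iff_of_eventuallyEq_mul (c := -w.2), neg_eq_zero]
  filter_upwards [eventually_pos_and_abs_mul_lt w.1 w.2] with t ht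
  obtain ⟨-, h1, h2⟩ := ht
  have := abs_lt.1 h2
  simp only [supNorm, Prod.fst_add, Prod.snd_add, Prod.smul_fst, Prod.smul_snd, smul_eq_mul,
    abs_neg, abs_one, abs_zero, zero_add]
  rw [abs_of_neg (by linarith : -1 + t * w.2 < 0), max_eq_right (by linarith),
    max_eq_right zero_le_one]
  ring

theorem isSupFlexAlong_blue (w : V2) : IsSupFlexAlong (-1, -1) w ↔ min w.1 w.2 = 0 := by
  rw [IsSupFlexAlong, isLittleO_id_iff_of_eventuallyEq_mul (c := -min w.1 w.2), neg_eq_zero]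
  filter_upwards [eventually_pos_and_abs_mul_lt w.1 w.2] with t ht
  obtain ⟨h0, h1, h2⟩ := ht
  have := abs_lt.1 h1
  have := abs_lt.1 h2
  simp only [supNorm, Prod.fst_add, Prod.snd_add, Prod.smul_fst, Prod.smul_snd, smul_eq_mul,
    abs_neg, abs_one, max_self]
  rw [abs_of_neg (by linarith : -1 + t * w.1 < 0), abs_of_neg (by linarith : -1 + t * w.2 < 0)]
  rcases le_total w.1 w.2 with h | h
  · have := mul_le_mul_of_nonneg_left h h0.le
    rw [min_eq_left h, max_eq_left (by linarith)]
    ring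
  · have := mul_le_mul_of_nonneg_left h h0.le
    rw [min_eq_right h, max_eq_right (by linarith)]
    ring

theorem isSupFlexAlong_red (w : V2) : IsSupFlexAlong (1, -1) w ↔ max w.1 (-w.2) = 0 := by
  rw [IsSupFlexAlong, isLittleO_id_iff_of_eventuallyEq_mul (c := max w.1 (-w.2))]
  filter_upwards [eventually_pos_and_abs_mul_lt w.1 w.2] with t ht
  obtain ⟨h0, h1, h2⟩ := ht
  have := abs_lt.1 h1
  have := abs_lt.1 h2
  simp only [supNorm, Prod.fst_add, Prod.snd_add, Prod.smul_fst, Prod.smul_snd, smul_eq_mul,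
    abs_neg, abs_one, max_self]
  rw [abs_of_pos (by linarith : 0 < 1 + t * w.1), abs_of_neg (by linarith : -1 + t * w.2 < 0)]
  rcases le_total w.1 (-w.2) with h | h
  · have := mul_le_mul_of_nonneg_left h h0.le
    rw [max_eq_right h, max_eq_right (by linarith)]
    ring
  · have := mul_le_mul_of_nonneg_left h h0.le
    rw [max_eq_left h, max_eq_left (by linarith)]
    ring

theorem forall_mem_gridBars_iff {m n : ℕ} {P : Joint m n × Joint m n → Prop} :
    (∀ e ∈ gridBars m n, P e) ↔
      (∀ (j : Fin m) (k : Fin (n + 1)), P ((j.castSucc, k), (j.succ, k))) ∧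
        ∀ (j : Fin (m + 1)) (k : Fin n), P ((j, k.castSucc), (j, k.succ)) := by
  constructor
  · intro h
    exact ⟨fun j k => h _ (Or.inl ⟨by simp, rfl⟩), fun j k => h _ (Or.inr ⟨rfl, by simp⟩)⟩
  · rintro ⟨h, v⟩ ⟨⟨j, k⟩, ⟨j', k'⟩⟩ (⟨h1, h2⟩ | ⟨h1, h2⟩)
    · dsimp only at h1 h2
      subst h2
      have hj : (j : ℕ) < m := by omega
      obtain rfl : j' = (⟨j, hj⟩ : Fin m).succ := Fin.ext h1.symm
      exact h ⟨j, hj⟩ k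
    · dsimp only at h1 h2
      subst h1
      have hk : (k : ℕ) < n := by omega
      obtain rfl : k' = (⟨k, hk⟩ : Fin n).succ := Fin.ext h2.symm
      exact v j ⟨k, hk⟩

theorem eq_apply_zero_of_castSucc_eq_succ {n : ℕ} {f : Fin (n + 1) → ℝ}
    (h : ∀ k : Fin n, f k.castSucc = f k.succ) (k : Fin (n + 1)) : f k = f 0 := by
  induction k using Fin.induction with
  | zero => rfl
  | succ i ih => rw [← h i, ih]

theorem exists_single_jump {n : ℕ} (k : Fin n) (c : ℝ) :
    ∃ X : Fin (n + 1) → ℝ, X k.castSucc - X k.succ = c ∧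
      ∀ i : Fin n, i ≠ k → X i.castSucc - X i.succ = 0 := by
  refine ⟨fun i => if i ≤ k.castSucc then c else 0, ?_, fun i hi => ?_⟩
  · simp [Fin.le_def]
  · have : (i : ℕ) ≠ k := fun h => hi (Fin.ext h)
    have : (i : ℕ) ≤ k ↔ (i : ℕ) + 1 ≤ k := by omega
    simp [Fin.le_def, this]

/-- The flexes of the braced grid for the sup norm: horizontal lines move horizontally with
velocities `X`, vertical lines move vertically with velocities `Y`. -/
theorem isFlex_supNorm_plainBracedGrid_iff {m n : ℕ} (B : Set (Brace m n))
    (u : Joint m n → V2) :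
    IsFlex supNorm (plainBracedGrid m n B) u ↔
      ∃ (X : Fin (n + 1) → ℝ) (Y : Fin (m + 1) → ℝ), (u = fun v => (X v.2, Y v.1)) ∧
        ∀ j k,
          ((j, k, true) ∈ B → min (X k.castSucc - X k.succ) (Y j.castSucc - Y j.succ) = 0) ∧
          ((j, k, false) ∈ B → max (X k.castSucc - X k.succ) (Y j.castSucc - Y j.succ) = 0) := by
  have hbraces : (∀ e ∈ braceBar '' B, IsSupFlexAlong ((plainBracedGrid m n B).pos e.1 -
        (plainBracedGrid m n B).pos e.2) (u e.1 - u e.2)) ↔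
      ∀ j k,
        ((j, k, true) ∈ B → min ((u (j.castSucc, k.castSucc)).1 - (u (j.succ, k.succ)).1)
          ((u (j.castSucc, k.castSucc)).2 - (u (j.succ, k.succ)).2) = 0) ∧
        ((j, k, false) ∈ B → max ((u (j.succ, k.castSucc)).1 - (u (j.castSucc, k.succ)).1)
          ((u (j.castSucc, k.succ)).2 - (u (j.succ, k.castSucc)).2) = 0) := by
    simp only [Set.forall_mem_image, Prod.forall, Bool.forall_bool]
    refine forall₂_congr fun j k => ?_
    rw [and_comm]
    refine and_congr (imp_congr_right fun _ => ?_) (imp_congr_right fun _ => ?_)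
    · simpa [braceBar, plainBracedGrid] using
        isSupFlexAlong_blue (u (j.castSucc, k.castSucc) - u (j.succ, k.succ))
    · simpa [braceBar, plainBracedGrid] using
        isSupFlexAlong_red (u (j.succ, k.castSucc) - u (j.castSucc, k.succ))
  have hgrid : (∀ e ∈ gridBars m n, IsSupFlexAlong ((plainBracedGrid m n B).pos e.1 -
        (plainBracedGrid m n B).pos e.2) (u e.1 - u e.2)) ↔
      (∀ (j : Fin m) (k : Fin (n + 1)), (u (j.castSucc, k)).1 = (u (j.succ, k)).1) ∧
        ∀ (j : Fin (m + 1)) (k : Fin n), (u (j, k.castSucc)).2 = (u (j, k.succ)).2 := by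
    rw [forall_mem_gridBars_iff]
    refine and_congr (forall₂_congr fun j k => ?_) (forall₂_congr fun j k => ?_)
    · simpa [plainBracedGrid, sub_eq_zero] using
        isSupFlexAlong_horizontal (u (j.castSucc, k) - u (j.succ, k))
    · simpa [plainBracedGrid, sub_eq_zero] using
        isSupFlexAlong_vertical (u (j, k.castSucc) - u (j, k.succ))
  have hbars : (plainBracedGrid m n B).bars = gridBars m n ∪ braceBar '' B := rfl
  rw [isFlex_supNorm_iff, hbars]
  simp only [Set.mem_union, or_imp]
  rw [forall_and, hgrid, hbraces]
  constructor
  · rintro ⟨⟨hh, hv⟩, hb⟩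
    have hX (j k) : (u (j, k)).1 = (u (0, k)).1 :=
      eq_apply_zero_of_castSucc_eq_succ (f := fun j => (u (j, k)).1) (fun j => hh j k) j
    have hY (j k) : (u (j, k)).2 = (u (j, 0)).2 :=
      eq_apply_zero_of_castSucc_eq_succ (f := fun k => (u (j, k)).2) (fun k => hv j k) k
    refine ⟨fun k => (u (0, k)).1, fun j => (u (j, 0)).2,
      funext fun v => Prod.ext (hX _ _) (hY _ _), fun j k => ?_⟩
    have := hb j k
    rwa [hX j.castSucc, hX j.succ, hX j.castSucc k.succ, hX j.succ, hY _ k.castSucc, hY _ k.succ,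
      hY _ k.succ, hY _ k.castSucc] at this
  · rintro ⟨X, Y, rfl, hb⟩
    exact ⟨⟨fun _ _ => rfl, fun _ _ => rfl⟩, hb⟩

theorem not_normRigid_of_horizontal_jump {m n : ℕ} {B : Set (Brace m n)} (k : Fin n) {c : ℝ}
    (hc : c ≠ 0)
    (hb : ∀ j, ((j, k, true) ∈ B → min c 0 = 0) ∧ ((j, k, false) ∈ B → max c 0 = 0)) :
    ¬NormRigid supNorm (plainBracedGrid m n B) := by
  intro hrigid
  obtain ⟨X, hX, hX'⟩ := exists_single_jump k c
  have heq := hrigid _ ((isFlex_supNorm_plainBracedGrid_iff B _).2 ⟨X, 0, rfl, fun j i => ?_⟩)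
    (0, k.castSucc) (0, k.succ)
  · exact hc (by rw [← hX, sub_eq_zero]; exact congrArg Prod.fst heq)
  · by_cases hi : i = k
    · subst hi
      simpa only [hX, Pi.zero_apply, sub_zero] using hb j
    · simp [hX' i hi]

theorem not_normRigid_of_vertical_jump {m n : ℕ} {B : Set (Brace m n)} (j : Fin m) {c : ℝ}
    (hc : c ≠ 0)
    (hb : ∀ k, ((j, k, true) ∈ B → min 0 c = 0) ∧ ((j, k, false) ∈ B → max 0 c = 0)) :
    ¬NormRigid supNorm (plainBracedGrid m n B) := by
  intro hrigid
  obtain ⟨Y, hY, hY'⟩ := exists_single_jump j c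
  have heq := hrigid _ ((isFlex_supNorm_plainBracedGrid_iff B _).2 ⟨0, Y, rfl, fun i k => ?_⟩)
    (j.castSucc, 0) (j.succ, 0)
  · exact hc (by rw [← hY, sub_eq_zero]; exact congrArg Prod.snd heq)
  · by_cases hi : i = j
    · subst hi
      simpa only [hY, Pi.zero_apply, sub_zero] using hb k
    · simp [hY' i hi]

/-- Proposition 3.7: an axis-aligned braced `m × n` grid of squares is
infinitesimally rigid for the sup norm iff every row and every column of squares carries
at least one blue brace and at least one red brace (equivalently, every ribbon contains a
brace of each diagonal type). -/
theorem statement16 (m n : ℕ) (hm : 1 ≤ m) (hn : 1 ≤ n) (B : Set (Brace m n)) :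
    NormRigid supNorm (plainBracedGrid m n B) ↔
      (∀ j : Fin m, (∃ k, (j, k, true) ∈ B) ∧ ∃ k, (j, k, false) ∈ B) ∧
        ∀ k : Fin n, (∃ j, (j, k, true) ∈ B) ∧ ∃ j, (j, k, false) ∈ B := by
  constructor
  · intro hrigid
    refine ⟨fun j => ⟨?_, ?_⟩, fun k => ⟨?_, ?_⟩⟩ <;> by_contra! hno
    · exact not_normRigid_of_vertical_jump j (c := -1) (by norm_num)
        (fun k => by simp [hno k]) hrigid
    · exact not_normRigid_of_vertical_jump j (c := 1) (by norm_num)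
        (fun k => by simp [hno k]) hrigid
    · exact not_normRigid_of_horizontal_jump k (c := -1) (by norm_num)
        (fun j => by simp [hno j]) hrigid
    · exact not_normRigid_of_horizontal_jump k (c := 1) (by norm_num)
        (fun j => by simp [hno j]) hrigid
  · rintro ⟨hcol, hrow⟩ u hu
    obtain ⟨X, Y, rfl, hb⟩ := (isFlex_supNorm_plainBracedGrid_iff B u).1 hu
    have hX : ∀ k : Fin n, X k.castSucc = X k.succ := fun k => by
      obtain ⟨⟨j, hj⟩, i, hi⟩ := hrow k
      have h1 := ((hb j k).1 hj).ge.trans (min_le_left _ _)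
      have h2 := (le_max_left _ _).trans ((hb i k).2 hi).le
      linarith
    have hY : ∀ j : Fin m, Y j.castSucc = Y j.succ := fun j => by
      obtain ⟨⟨k, hk⟩, i, hi⟩ := hcol j
      have h1 := ((hb j k).1 hk).ge.trans (min_le_right _ _)
      have h2 := (le_max_right _ _).trans ((hb j i).2 hi).le
      linarith
    intro v w
    simp only [eq_apply_zero_of_castSucc_eq_succ hX v.2,
      eq_apply_zero_of_castSucc_eq_succ hX w.2, eq_apply_zero_of_castSucc_eq_succ hY v.1,
      eq_apply_zero_of_castSucc_eq_succ hY w.1]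
end

section
/- Every Euclidean infinitesimal flex u: ℤ² → ℝ² of the infinite unbraced grid framework G_∞ has a unique representation u = Σ_{l ∈ L_x} a_l u_l + Σ_{l ∈ L_y} b_l u_l, where L_x and L_y are the sets of horizontal and vertical lines of the grid and the sum is well defined since at each joint only the two lines through that joint contribute. -/
open Asymptotics

/-- The bars of the infinite grid on `ℤ²`. -/
def infGridBars : Set ((ℤ × ℤ) × (ℤ × ℤ)) :=
  {e | (e.2.1 = e.1.1 + 1 ∧ e.2.2 = e.1.2) ∨ (e.2.1 = e.1.1 ∧ e.2.2 = e.1.2 + 1)}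

/-- The infinite unbraced grid framework `G_∞`. -/
noncomputable def infGrid : Framework (ℤ × ℤ) where
  pos := fun v => ((v.1 : ℝ), (v.2 : ℝ))
  bars := infGridBars

/-- A function on `ℤ` invariant under the unit shift is constant. -/
theorem Int.eq_apply_zero_of_apply_add_one_eq {α : Type*} {f : ℤ → α}
    (h : ∀ j, f (j + 1) = f j) (j : ℤ) : f j = f 0 := by
  simpa using (show Function.Periodic f 1 from h).int_mul j 0

/-- An infinitesimal flex of the infinite grid has constant horizontal component along
each horizontal line. -/
theorem IsEucFlex.infGrid_fst {u : ℤ × ℤ → V2} (hu : IsEucFlex infGrid u) (j k : ℤ) :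
    (u (j, k)).1 = (u (0, k)).1 := by
  refine Int.eq_apply_zero_of_apply_add_one_eq (f := fun j => (u (j, k)).1) (fun j => ?_) j
  have h := hu ((j, k), (j + 1, k)) (Or.inl ⟨rfl, rfl⟩)
  simp [dot, infGrid] at h
  linarith

/-- An infinitesimal flex of the infinite grid has constant vertical component along
each vertical line. -/
theorem IsEucFlex.infGrid_snd {u : ℤ × ℤ → V2} (hu : IsEucFlex infGrid u) (j k : ℤ) :
    (u (j, k)).2 = (u (j, 0)).2 := by
  refine Int.eq_apply_zero_of_apply_add_one_eq (f := fun k => (u (j, k)).2) (fun k => ?_) k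
  have h := hu ((j, k), (j, k + 1)) (Or.inr ⟨rfl, rfl⟩)
  simp [dot, infGrid] at h
  linarith

/-- Lemma 4.1: every Euclidean infinitesimal flex of the infinite
unbraced grid `G_∞` has a unique representation `u = Σ_{l ∈ L_x} a_l u_l +
Σ_{l ∈ L_y} b_l u_l`; pointwise, `u (j,k) = a_k • (1,0) + b_j • (0,1)` for unique
coefficient families `a, b : ℤ → ℝ`. -/
theorem statement17 (u : ℤ × ℤ → V2) (hu : IsEucFlex infGrid u) :
    ∃! ab : (ℤ → ℝ) × (ℤ → ℝ), ∀ j k : ℤ,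
      u (j, k) = ab.1 k • ((1 : ℝ), (0 : ℝ)) + ab.2 j • ((0 : ℝ), (1 : ℝ)) := by
  refine ⟨(fun k => (u (0, k)).1, fun j => (u (j, 0)).2), fun j k => ?_, ?_⟩
  · ext
    · simpa using hu.infGrid_fst j k
    · simpa using hu.infGrid_snd j k
  · rintro ⟨a, b⟩ hab
    ext i
    · simp [hab 0 i]
    · simp [hab i 0]
end

section
/- An infinite braced grid G_∞(B) in the Euclidean plane (ℝ²,‖·‖₂) is infinitesimally rigid if and only if its braces graph is a connected spanning subgraph of the complete bipartite graph K_{∞,∞} on the rows and columns of squares. -/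
open Asymptotics

/-- The diagonal bar of a brace of the infinite grid (`true` = blue diagonal of the
square with lower-left corner `(j,k)`, `false` = red diagonal). -/
def infBraceBar (b : ℤ × ℤ × Bool) : (ℤ × ℤ) × (ℤ × ℤ) :=
  if b.2.2 then ((b.1, b.2.1), (b.1 + 1, b.2.1 + 1))
  else ((b.1 + 1, b.2.1), (b.1, b.2.1 + 1))

/-- The infinite braced grid framework `G_∞(B)`. -/
noncomputable def infBracedGrid (B : Set (ℤ × ℤ × Bool)) : Framework (ℤ × ℤ) where
  pos := fun v => ((v.1 : ℝ), (v.2 : ℝ))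
  bars := infGridBars ∪ infBraceBar '' B

/-- Adjacency of rows (`Sum.inl`) and columns (`Sum.inr`) in the braces graph of an
infinite braced grid, a subgraph of `K_{∞,∞}`. -/
def infBracesAdj (B : Set (ℤ × ℤ × Bool)) (v w : ℤ ⊕ ℤ) : Prop :=
  ∃ e ∈ B, (v = Sum.inl e.1 ∧ w = Sum.inr e.2.1) ∨ (w = Sum.inl e.1 ∧ v = Sum.inr e.2.1)

/-- Every integer sequence of reals has an antidifference. -/
theorem exists_antidifference (h : ℤ → ℝ) : ∃ F : ℤ → ℝ, ∀ n, F (n + 1) - F n = h n := by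
  refine ⟨fun n => ∑ i ∈ Finset.Ico 0 n, h i - ∑ i ∈ Finset.Ico n 0, h i, fun n => ?_⟩
  dsimp only
  rcases le_or_gt 0 n with hn | hn
  · have hIco : Finset.Ico 0 (n + 1) = insert n (Finset.Ico 0 n) := by
      ext i; simp only [Finset.mem_Ico, Finset.mem_insert]; omega
    rw [hIco, Finset.sum_insert (by simp), Finset.Ico_eq_empty_of_le hn,
      Finset.Ico_eq_empty_of_le (by omega : (0 : ℤ) ≤ n + 1)]
    simp
  · have hIco : Finset.Ico n 0 = insert n (Finset.Ico (n + 1) 0) := by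
      ext i; simp only [Finset.mem_Ico, Finset.mem_insert]; omega
    rw [hIco, Finset.sum_insert (by simp), Finset.Ico_eq_empty_of_le hn.le,
      Finset.Ico_eq_empty_of_le (by omega : n + 1 ≤ (0 : ℤ))]
    simp

/-- A sequence on `ℤ` with constant difference is affine. -/
theorem eq_add_mul_of_sub_eq {F : ℤ → ℝ} {t : ℝ} (h : ∀ n, F (n + 1) - F n = t) (n : ℤ) :
    F n = F 0 + n * t := by
  induction n using Int.induction_on with
  | zero => simp
  | succ i ih =>
    have := h i
    push_cast at *
    linarith
  | pred i ih =>
    have := h (-i - 1)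
    rw [sub_add_cancel] at this
    push_cast at *
    linarith

theorem infBracesAdj_symm {B : Set (ℤ × ℤ × Bool)} {v w : ℤ ⊕ ℤ}
    (h : infBracesAdj B v w) : infBracesAdj B w v :=
  let ⟨e, he, h⟩ := h
  ⟨e, he, h.symm⟩

/-- The flexes of a braced grid are the fields `(j, k) ↦ (f k, g j)` whose ribbon sheers agree
at each braced square. -/
theorem isEucFlex_infBracedGrid_iff (B : Set (ℤ × ℤ × Bool)) (u : ℤ × ℤ → V2) :
    IsEucFlex (infBracedGrid B) u ↔
      ∃ f g : ℤ → ℝ, (∀ v, u v = (f v.2, g v.1)) ∧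
        ∀ e ∈ B, g (e.1 + 1) - g e.1 = -(f (e.2.1 + 1) - f e.2.1) := by
  constructor
  · intro hu
    have hx (j k : ℤ) : (u (j + 1, k)).1 - (u (j, k)).1 = 0 := by
      have := hu ((j, k), (j + 1, k)) (Or.inl (Or.inl ⟨rfl, rfl⟩))
      simp [dot, infBracedGrid] at this
      linarith
    have hy (j k : ℤ) : (u (j, k + 1)).2 - (u (j, k)).2 = 0 := by
      have := hu ((j, k), (j, k + 1)) (Or.inl (Or.inr ⟨rfl, rfl⟩))
      simp [dot, infBracedGrid] at this
      linarith
    have hform (v : ℤ × ℤ) : u v = ((u (0, v.2)).1, (u (v.1, 0)).2) := by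
      obtain ⟨j, k⟩ := v
      have h₁ := eq_add_mul_of_sub_eq (F := fun j => (u (j, k)).1) (fun j => hx j k) j
      have h₂ := eq_add_mul_of_sub_eq (F := fun k => (u (j, k)).2) (fun k => hy j k) k
      ext
      · simpa using h₁
      · simpa using h₂
    refine ⟨fun k => (u (0, k)).1, fun j => (u (j, 0)).2, hform, ?_⟩
    rintro ⟨j, k, c⟩ he
    have := hu _ (Or.inr ⟨_, he, rfl⟩)
    cases c
    · simp only [infBraceBar, infBracedGrid, dot, Bool.false_eq_true, if_false] at this
      rw [hform (j + 1, k), hform (j, k + 1)] at this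
      simp at this
      simp only
      linarith
    · simp only [infBraceBar, infBracedGrid, dot, if_true] at this
      rw [hform (j + 1, k + 1), hform (j, k)] at this
      simp at this
      simp only
      linarith
  · rintro ⟨f, g, hu, hB⟩ e (he | ⟨⟨j, k, c⟩, hb, rfl⟩)
    · obtain ⟨⟨j, k⟩, ⟨j', k'⟩⟩ := e
      rcases he with ⟨h₁, h₂⟩ | ⟨h₁, h₂⟩ <;> simp only at h₁ h₂ <;> subst h₁ h₂ <;>
        simp [hu, dot, infBracedGrid]
    · have := hB _ hb
      cases c <;> simp [infBraceBar, hu, dot, infBracedGrid] at this ⊢ <;> linarith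

/-- Theorem 4.2: an infinite Euclidean braced grid `G_∞(B)` is
infinitesimally rigid iff its braces graph is a connected spanning subgraph of `K_{∞,∞}`,
i.e. all row and column vertices are joined to each other by paths of braces. -/
theorem statement18 (B : Set (ℤ × ℤ × Bool)) :
    EucRigid (infBracedGrid B) ↔
      ∀ v w : ℤ ⊕ ℤ, Relation.ReflTransGen (infBracesAdj B) v w := by
  classical
  constructor
  · intro hrigid v w
    set s : ℤ ⊕ ℤ → ℝ := fun x => if Relation.ReflTransGen (infBracesAdj B) v x then 1 else 0
      with hs
    obtain ⟨g, hg⟩ := exists_antidifference fun j => s (Sum.inl j)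
    obtain ⟨f, hf⟩ := exists_antidifference fun k => -s (Sum.inr k)
    have hflex : IsEucFlex (infBracedGrid B) fun v => (f v.2, g v.1) := by
      refine (isEucFlex_infBracedGrid_iff B _).2 ⟨f, g, fun _ => rfl, fun e he => ?_⟩
      have hadj : infBracesAdj B (Sum.inl e.1) (Sum.inr e.2.1) := ⟨e, he, Or.inl ⟨rfl, rfl⟩⟩
      have hiff : Relation.ReflTransGen (infBracesAdj B) v (Sum.inl e.1) ↔
          Relation.ReflTransGen (infBracesAdj B) v (Sum.inr e.2.1) :=
        ⟨fun h => h.tail hadj, fun h => h.tail (infBracesAdj_symm hadj)⟩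
      rw [hg, hf]
      simp [hs, hiff]
    obtain ⟨c, θ, hc⟩ := hrigid _ hflex
    have hconst (x : ℤ ⊕ ℤ) : s x = θ := by
      rcases x with j | k
      · have h₀ := congrArg Prod.snd (hc (j, 0))
        have h₁ := congrArg Prod.snd (hc (j + 1, 0))
        simp [infBracedGrid, rot90] at h₀ h₁
        rw [← hg, h₀, h₁]
        ring
      · have h₀ := congrArg Prod.fst (hc (0, k))
        have h₁ := congrArg Prod.fst (hc (0, k + 1))
        simp [infBracedGrid, rot90] at h₀ h₁
        rw [← neg_neg (s _), ← hf, h₀, h₁]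
        ring
    have hvw : s w = s v := (hconst w).trans (hconst v).symm
    by_contra hw
    simp [hs, hw, Relation.ReflTransGen.refl] at hvw
  · intro hconn u hu
    obtain ⟨f, g, hfg, hB⟩ := (isEucFlex_infBracedGrid_iff B u).1 hu
    set s : ℤ ⊕ ℤ → ℝ := Sum.elim (fun j => g (j + 1) - g j) (fun k => -(f (k + 1) - f k))
    have hadj {x y : ℤ ⊕ ℤ} (h : infBracesAdj B x y) : s x = s y := by
      rcases h with ⟨e, he, ⟨rfl, rfl⟩ | ⟨rfl, rfl⟩⟩
      · exact hB e he
      · exact (hB e he).symm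
    have hconst (x : ℤ ⊕ ℤ) : s x = s (Sum.inl 0) := by
      induction hconn (Sum.inl 0) x with
      | refl => rfl
      | tail _ h ih => rw [← hadj h, ih]
    refine ⟨(f 0, g 0), s (Sum.inl 0), fun v => ?_⟩
    have h₁ := eq_add_mul_of_sub_eq (fun j => hconst (Sum.inl j)) v.1
    have h₂ := eq_add_mul_of_sub_eq (fun k => neg_eq_iff_eq_neg.1 (hconst (Sum.inr k))) v.2
    rw [hfg, h₁, h₂]
    ext <;> simp [infBracedGrid, rot90] <;> ring
end
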